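/- arXiv:math/0409496 — 2 statements merged into one kernel-verified Lean document; each statement's English description precedes it below -/
import Mathlib

section
/- Let R be a Gorenstein ring and M an unmixed finitely generated R-module (all associated primes of the same height). Then the canonical homomorphism M → K_{K_M} is injective. -/
open CategoryTheory Opposite

noncomputable section

universe u

/-- The Ext modules `Ext^n_R(M, N)`. -/
noncomputable def RExt (R : Type) [CommRing R] (M N : ModuleCat R) (n : ℕ) : ModuleCat R :=
  ((Ext R (ModuleCat R) n).obj (op M)).obj N

/-- The (Krull) dimension of a module, i.e. the dimension of `R / Ann M`. -/
noncomputable def mDim (R : Type) [CommRing R] (M : Type) [AddCommGroup M] [Module R M] :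
    WithBot (WithTop ℕ) :=
  ringKrullDim (R ⧸ Module.annihilator R M)

/-- A (local) Gorenstein ring: Noetherian, local, and of finite self-injective dimension
(expressed via vanishing of `Ext^i(-, R)` for large `i`). -/
def IsGorensteinRing (R : Type) [CommRing R] : Prop :=
  IsNoetherianRing R ∧ IsLocalRing R ∧
    ∃ n : ℕ, ∀ (N : ModuleCat R) (i : ℕ), n < i →
      Subsingleton (RExt R N (ModuleCat.of R R) i)

/-- A module has finite projective dimension, expressed via vanishing of `Ext^i(M, -)`
for all large `i`. -/
def HasFiniteProjDim (R : Type) [CommRing R] (M : ModuleCat R) : Prop :=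
  ∃ n : ℕ, ∀ (N : ModuleCat R) (i : ℕ), n < i → Subsingleton (RExt R M N i)

/-- A finitely generated module over a Noetherian local ring is Cohen-Macaulay iff its depth
equals its dimension, i.e. `Ext^i(k, M) ≠ 0` forces `i = dim M`. -/
def IsCohenMacaulayMod (R : Type) [CommRing R] [IsLocalRing R] (M : ModuleCat R) : Prop :=
  ∀ i : ℕ,
    Nontrivial (RExt R (ModuleCat.of R (R ⧸ IsLocalRing.maximalIdeal R)) M i) →
      (i : WithBot (WithTop ℕ)) = mDim R M

/-- A perfect module: Cohen-Macaulay with finite projective dimension. -/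
def IsPerfectMod (R : Type) [CommRing R] [IsLocalRing R] (M : ModuleCat R) : Prop :=
  IsCohenMacaulayMod R M ∧ HasFiniteProjDim R M

/-- The "canonical module" `K_M = Ext^c_R(M, R)` of a module of codimension `c`
(in the local case, where no twist is needed). -/
noncomputable def KMod (R : Type) [CommRing R] (M : ModuleCat R) (c : ℕ) : ModuleCat R :=
  RExt R M (ModuleCat.of R R) c

/-- The height of a prime ideal. -/
noncomputable def pHeight (R : Type) [CommRing R] (p : Ideal R) (hp : p.IsPrime) :
    WithTop ℕ :=
  Order.height (⟨p, hp⟩ : PrimeSpectrum R)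

/-- A module is unmixed if all of its associated primes have the same height. -/
def IsUnmixedMod (R : Type) [CommRing R] (M : Type) [AddCommGroup M] [Module R M] : Prop :=
  ∀ p q, ∀ (hp : p ∈ associatedPrimes R M) (hq : q ∈ associatedPrimes R M),
    pHeight R p hp.isPrime = pHeight R q hq.isPrime

/-- A module has pure codimension `c` if all of its associated primes have height `c`. -/
def IsPureCodim (R : Type) [CommRing R] (M : Type) [AddCommGroup M] [Module R M] (c : ℕ) :
    Prop :=
  ∀ p, ∀ hp : p ∈ associatedPrimes R M, pHeight R p hp.isPrime = c

/-- A quasi-Gorenstein module of codimension `c`: a perfect module isomorphic to its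
canonical module (no twist in the local case). -/
def IsQuasiGorenstein (R : Type) [CommRing R] [IsLocalRing R] (M : ModuleCat R) (c : ℕ) :
    Prop :=
  IsPerfectMod R M ∧ mDim R M + (c : WithBot (WithTop ℕ)) = ringKrullDim R ∧
    Nonempty (M ≃ₗ[R] KMod R M c)

/-- A short exact sequence `0 → A → B → C → 0` of modules, given by linear maps. -/
def IsSES (R : Type) [CommRing R] {A B C : Type} [AddCommGroup A] [Module R A]
    [AddCommGroup B] [Module R B] [AddCommGroup C] [Module R C]
    (f : A →ₗ[R] B) (g : B →ₗ[R] C) : Prop :=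
  Function.Injective f ∧ Function.Surjective g ∧ Function.Exact f g

/-- `M` and `N` are directly module-linked by the quasi-Gorenstein module `C` of
codimension `c` (local case): both are unmixed of the same dimension as `C` and there are
the two standard exact sequences `0 → K_N → C → M → 0` and `0 → K_M → C → N → 0`. -/
def DirectlyLinked (R : Type) [CommRing R] [IsLocalRing R] (C M N : ModuleCat R) (c : ℕ) :
    Prop :=
  IsQuasiGorenstein R C c ∧
    IsUnmixedMod R M ∧ IsUnmixedMod R N ∧ mDim R M = mDim R C ∧ mDim R N = mDim R C ∧
    (∃ (f : KMod R N c →ₗ[R] C) (g : C →ₗ[R] M), IsSES R f g) ∧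
    (∃ (f : KMod R M c →ₗ[R] C) (g : C →ₗ[R] N), IsSES R f g)

/-- Being linked in `k` steps. -/
def LinkedChain (R : Type) [CommRing R] [IsLocalRing R] : ℕ → ModuleCat R → ModuleCat R → Prop
  | 0, M, N => Nonempty (M ≃ₗ[R] N)
  | (k + 1), M, N => ∃ (C P : ModuleCat R) (c : ℕ),
      DirectlyLinked R C M P c ∧ LinkedChain R k P N

end

/-- An ideal generated by a weakly regular sequence has height at least the length of the
sequence. -/
theorem length_le_height_ofList {R : Type*} [CommRing R] [IsNoetherianRing R] (rs : List R)
    (hrs : RingTheory.Sequence.IsWeaklyRegular R rs) :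
    (rs.length : ℕ∞) ≤ (Ideal.ofList rs).height := by
  rw [Ideal.height_eq_inf_minimalPrimes]
  refine le_iInf₂ fun J hJ ↦ ?_
  have := hJ.isPrime
  have hmem : ∀ r ∈ rs, r ∈ J := fun r hr ↦ hJ.1.2 (Ideal.subset_span hr)
  have hreg := hrs.isRegular_of_isLocalization_of_mem (Localization.AtPrime J) J hmem
  have hdim := ringKrullDim_add_length_eq_ringKrullDim_of_isRegular _ hreg
  rw [IsLocalization.AtPrime.ringKrullDim_eq_height J (Localization.AtPrime J),
    List.length_map] at hdim
  have hnt : Nontrivial (Localization.AtPrime J ⧸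
      Ideal.ofList (rs.map (algebraMap R (Localization.AtPrime J)))) := by
    refine Ideal.Quotient.nontrivial_iff.mpr fun h ↦ hreg.2 ?_
    rw [h, Submodule.top_smul]
  have h0 : 0 ≤ ringKrullDim (Localization.AtPrime J ⧸
      Ideal.ofList (rs.map (algebraMap R (Localization.AtPrime J)))) :=
    ringKrullDim_nonneg_of_nontrivial
  have : ((rs.length : ℕ∞) : WithBot ℕ∞) ≤ (J.height : WithBot ℕ∞) := by
    rw [← hdim]
    exact le_add_of_nonneg_left h0
  exact WithBot.coe_le_coe.mp this

/-- If `R / A` has dimension at least `d`, some minimal prime `q` of `A` satisfies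
`height q + d ≤ dim R`. -/
theorem exists_minimalPrimes_height_add_le {R : Type*} [CommRing R] (A : Ideal R) (d : ℕ)
    (hd : (d : WithBot ℕ∞) ≤ ringKrullDim (R ⧸ A)) :
    ∃ q ∈ A.minimalPrimes, (q.height : WithBot ℕ∞) + d ≤ ringKrullDim R := by
  obtain ⟨l, rfl⟩ := Order.le_krullDim_iff.mp hd
  have hmono : StrictMono (PrimeSpectrum.comap (Ideal.Quotient.mk A)) :=
    Monotone.strictMono_of_injective (fun _ _ h ↦ Ideal.comap_mono h)
      (PrimeSpectrum.comap_injective_of_surjective _ Ideal.Quotient.mk_surjective)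
  have hle : A ≤ (PrimeSpectrum.comap (Ideal.Quotient.mk A) l.head).asIdeal := fun x hx ↦ by
    simp [Ideal.Quotient.eq_zero_iff_mem.mpr hx]
  obtain ⟨q, hq, hql⟩ := Ideal.exists_minimalPrimes_le hle
  refine ⟨q, hq, ?_⟩
  have := hq.isPrime
  let q' : PrimeSpectrum R := ⟨q, hq.isPrime⟩
  have hco : (l.length : ℕ∞) ≤ Order.coheight q' :=
    Order.length_le_coheight (p := l.map _ hmono) hql
  have : Nonempty (PrimeSpectrum R) := ⟨q'⟩
  rw [ringKrullDim, Order.krullDim_eq_iSup_height_add_coheight_of_nonempty]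
  have h1 : q.height + l.length ≤ ⨆ a : PrimeSpectrum R, Order.height a + Order.coheight a :=
    le_iSup_of_le q' (add_le_add (PrimeSpectrum.height_eq_orderHeight q').le hco)
  exact_mod_cast h1

/-- Vanishing of the derived-functor `Ext` implies vanishing of the Yoneda-type `Abelian.Ext`. -/
theorem subsingleton_abelianExt_of_subsingleton_ext {R : Type*} [CommRing R] {C : Type*}
    [Category* C] [Abelian C] [Linear R C] [EnoughProjectives C] [HasExt C] {X Y : C} {n : ℕ}
    (h : Subsingleton (((Ext R C (n + 1)).obj (op X)).obj Y)) :
    Subsingleton (Abelian.Ext X Y (n + 1)) := by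
  let P := ProjectiveResolution.of X
  have hz : Limits.IsZero ((P.complex.linearYonedaObj R Y).homology (n + 1)) :=
    (ModuleCat.isZero_of_subsingleton _).of_iso (P.isoExt (R := R) (n + 1) Y).symm
  rw [← HomologicalComplex.exactAt_iff_isZero_homology,
    HomologicalComplex.exactAt_iff' _ n (n + 1) (n + 2) (by simp) (by simp),
    ShortComplex.moduleCat_exact_iff] at hz
  refine subsingleton_of_forall_eq 0 fun α ↦ ?_
  obtain ⟨f, hf, rfl⟩ := P.extMk_surjective α (n + 2) rfl
  rw [P.extMk_eq_zero_iff f (n + 2) rfl hf n rfl]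
  exact hz f hf

section

universe u

variable {R : Type u} [CommRing R]

namespace ModuleCat

theorem smul_abelianExt_eq_zero {N T : ModuleCat.{u} R} {r : R} (hr : ∀ x : N, r • x = 0) {i : ℕ}
    (e : Abelian.Ext N T i) : r • e = 0 := by
  have h0 : r • 𝟙 N = 0 := by
    ext x
    exact hr x
  rw [← Abelian.Ext.mk₀_id_comp e, ← Abelian.Ext.smul_comp, ← Abelian.Ext.mk₀_smul, h0,
    Abelian.Ext.mk₀_zero, Abelian.Ext.zero_comp]

theorem comp_mk₀_smulShortComplex_f {N T : ModuleCat.{u} R} (r : R) {i : ℕ}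
    (e : Abelian.Ext N T i) :
    e.comp (Abelian.Ext.mk₀ (T.smulShortComplex r).f) (add_zero i) = r • e := by
  rw [smulShortComplex_f_eq_smul_id, Abelian.Ext.smul_eq_comp_mk₀]
  rfl

theorem subsingleton_abelianExt_of_isWeaklyRegular (rs : List R) (N T : ModuleCat.{u} R)
    (hrs : RingTheory.Sequence.IsWeaklyRegular T rs) (hN : ∀ r ∈ rs, ∀ x : N, r • x = 0)
    {i : ℕ} (hi : i < rs.length) : Subsingleton (Abelian.Ext N T i) := by
  induction rs generalizing T i with
  | nil => simp at hi
  | cons r rs ih =>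
    rw [RingTheory.Sequence.isWeaklyRegular_cons_iff] at hrs
    have hS := hrs.1.smulShortComplex_shortExact (M := T)
    refine subsingleton_of_forall_eq 0 fun e ↦ ?_
    have he : e.comp (Abelian.Ext.mk₀ (T.smulShortComplex r).f) (add_zero i) = 0 := by
      rw [comp_mk₀_smulShortComplex_f]
      exact smul_abelianExt_eq_zero (hN r (by simp)) e
    match i with
    | 0 =>
      have := hS.mono_f
      refine Abelian.Ext.postcomp_mk₀_injective_of_mono N (T.smulShortComplex r).f ?_
      exact he.trans (map_zero _).symm
    | i + 1 =>
      obtain ⟨y, rfl⟩ := Abelian.Ext.covariant_sequence_exact₁ N hS e he rfl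
      have : Subsingleton (Abelian.Ext N (T.smulShortComplex r).X₃ i) :=
        ih (ModuleCat.of R (QuotSMulTop r T)) hrs.2 (fun s hs ↦ hN s (by simp [hs]))
          (by simpa using hi)
      rw [Subsingleton.elim y 0, Abelian.Ext.zero_comp]
      rfl

/-- `ExtLifts f s T i` asserts that `s` times any class in `Ext^i(A, T)` extends along
`f : A ⟶ B`. -/
def ExtLifts {A B : ModuleCat.{u} R} (f : A ⟶ B) (s : R) (T : ModuleCat.{u} R) (i : ℕ) : Prop :=
  ∀ e : Abelian.Ext A T i, ∃ e' : Abelian.Ext B T i,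
    (Abelian.Ext.mk₀ f).comp e' (zero_add i) = s • e

theorem ExtLifts.of_iso {A B : ModuleCat.{u} R} {f : A ⟶ B} {s : R} {T T' : ModuleCat.{u} R}
    {i : ℕ} (h : ExtLifts f s T i) (φ : T ≅ T') : ExtLifts f s T' i := by
  intro e
  obtain ⟨e', he'⟩ := h (e.comp (Abelian.Ext.mk₀ φ.inv) (add_zero i))
  refine ⟨e'.comp (Abelian.Ext.mk₀ φ.hom) (add_zero i), ?_⟩
  rw [← Abelian.Ext.comp_assoc_of_third_deg_zero, he', Abelian.Ext.smul_comp,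
    Abelian.Ext.comp_assoc_of_third_deg_zero, Abelian.Ext.mk₀_comp_mk₀, φ.inv_hom_id,
    Abelian.Ext.comp_mk₀_id]

theorem ExtLifts.quotSMulTop {A B : ModuleCat.{u} R} {f : A ⟶ B} {s : R} {T : ModuleCat.{u} R}
    {i : ℕ} (h : ExtLifts f s T (i + 1)) {r : R} (hr : IsSMulRegular T r)
    (hB : ∀ x : B, r • x = 0) (hA : Subsingleton (Abelian.Ext A T i)) :
    ExtLifts f s (of R (QuotSMulTop r T)) i := by
  have hS := hr.smulShortComplex_shortExact (M := T)
  change ExtLifts f s (T.smulShortComplex r).X₃ i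
  intro e
  obtain ⟨y, hy⟩ := h (e.comp hS.extClass rfl)
  obtain ⟨e', rfl⟩ := Abelian.Ext.covariant_sequence_exact₁ B hS y
    ((comp_mk₀_smulShortComplex_f r y).trans (smul_abelianExt_eq_zero hB y)) rfl
  refine ⟨e', sub_eq_zero.mp ?_⟩
  obtain ⟨z, hz⟩ := Abelian.Ext.covariant_sequence_exact₃ A hS
    ((Abelian.Ext.mk₀ f).comp e' (zero_add i) - s • e) rfl (by
      rw [sub_eq_add_neg, Abelian.Ext.add_comp, Abelian.Ext.neg_comp, Abelian.Ext.smul_comp]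
      exact add_neg_eq_zero.mpr ((Abelian.Ext.comp_assoc _ _ _ _ _ (by lia)).trans hy))
  have : Subsingleton (Abelian.Ext A (T.smulShortComplex r).X₂ i) := hA
  rw [← hz, Subsingleton.elim z 0, Abelian.Ext.zero_comp]

theorem ExtLifts.quotient_ofList {A B : ModuleCat.{u} R} {f : A ⟶ B} {s : R}
    {rs : List R} {T : ModuleCat.{u} R} (hrs : RingTheory.Sequence.IsWeaklyRegular T rs)
    (hA : ∀ r ∈ rs, ∀ x : A, r • x = 0) (hB : ∀ r ∈ rs, ∀ x : B, r • x = 0)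
    (h : ExtLifts f s T rs.length) :
    ExtLifts f s (of R (T ⧸ (Ideal.ofList rs • ⊤ : Submodule R T))) 0 := by
  induction rs generalizing T with
  | nil =>
    refine h.of_iso (Submodule.quotEquivOfEqBot _ ?_).symm.toModuleIso
    rw [Ideal.ofList_nil, Submodule.bot_smul]
  | cons r rs ih =>
    have hvan := subsingleton_abelianExt_of_isWeaklyRegular (r :: rs) A T hrs hA
      (i := rs.length) (by simp)
    rw [RingTheory.Sequence.isWeaklyRegular_cons_iff] at hrs
    have h' : ExtLifts f s (of R (QuotSMulTop r T)) rs.length :=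
      ExtLifts.quotSMulTop h hrs.1 (hB r (by simp)) hvan
    exact (ih hrs.2 (fun t ht ↦ hA t (by simp [ht])) (fun t ht ↦ hB t (by simp [ht])) h').of_iso
      (Submodule.quotOfListConsSMulTopEquivQuotSMulTopInner T r rs).symm.toModuleIso

theorem ExtLifts.exists_comp_eq_smul {A B : ModuleCat.{u} R} {f : A ⟶ B} {s : R}
    {T : ModuleCat.{u} R} (h : ExtLifts f s T 0) (g : A ⟶ T) : ∃ g' : B ⟶ T, f ≫ g' = s • g := by
  obtain ⟨e, he⟩ := h (Abelian.Ext.mk₀ g)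
  obtain ⟨g', rfl⟩ := (Abelian.Ext.mk₀_bijective B T).2 e
  refine ⟨g', (Abelian.Ext.mk₀_bijective A T).1 ?_⟩
  rw [← Abelian.Ext.mk₀_comp_mk₀, he, Abelian.Ext.mk₀_smul]

/-- Obstruction to lifting along the monomorphism of a short exact sequence. -/
theorem extLifts_of_shortExact {S : ShortComplex (ModuleCat.{u} R)} (hS : S.ShortExact) {s : R}
    {T : ModuleCat.{u} R} {i : ℕ} (h : ∀ e : Abelian.Ext S.X₃ T (i + 1), s • e = 0) :
    ExtLifts S.f s T i := fun e ↦
  Abelian.Ext.contravariant_sequence_exact₁ hS T (s • e) (add_comm 1 i) <| by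
    rw [Abelian.Ext.comp_smul]
    exact h _

/-- The product of elements killing `Ext^i(-, T)` of the outer terms of a short exact sequence kills
`Ext^i(-, T)` of the middle term. -/
theorem smul_abelianExt_eq_zero_of_shortExact {S : ShortComplex (ModuleCat.{u} R)}
    (hS : S.ShortExact) {T : ModuleCat.{u} R} {i : ℕ} {s t : R}
    (hs : ∀ e : Abelian.Ext S.X₁ T i, s • e = 0) (ht : ∀ e : Abelian.Ext S.X₃ T i, t • e = 0)
    (e : Abelian.Ext S.X₂ T i) : (t * s) • e = 0 := by
  obtain ⟨y, hy⟩ := Abelian.Ext.contravariant_sequence_exact₂ hS T (s • e) <| by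
    rw [Abelian.Ext.comp_smul, hs]
  rw [mul_smul, ← hy, ← Abelian.Ext.comp_smul, ht, Abelian.Ext.comp_zero]

theorem smul_abelianExt_eq_zero_of_iso {A B T : ModuleCat.{u} R} (φ : A ≅ B) {i : ℕ} {s : R}
    (hs : ∀ e : Abelian.Ext B T i, s • e = 0) (e : Abelian.Ext A T i) : s • e = 0 := by
  have h := congrArg (fun e' ↦ (Abelian.Ext.mk₀ φ.hom).comp e' (zero_add i))
    (hs ((Abelian.Ext.mk₀ φ.inv).comp e (zero_add i)))
  simpa [Abelian.Ext.comp_smul] using h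

/-- Let `p` be a minimal prime of `I`. If `Ext^i(R / p, T)` is killed by an element outside `p`,
then so is `Ext^i(N, T)` for every finitely generated `R / I`-module `N`. -/
theorem exists_notMem_smul_abelianExt_eq_zero_of_quotient [IsNoetherianRing R] {I p : Ideal R}
    (hp : p ∈ I.minimalPrimes) {T : ModuleCat.{u} R} {i : ℕ}
    (hq : ∃ s ∉ p, ∀ e : Abelian.Ext (of R (R ⧸ p)) T i, s • e = 0)
    (N : Type u) [AddCommGroup N] [Module R N] [hN : Module.Finite R N]
    (hann : I ≤ Module.annihilator R N) :
    ∃ s ∉ p, ∀ e : Abelian.Ext (of R N) T i, s • e = 0 := by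
  induction hN using IsNoetherianRing.induction_on_isQuotientEquivQuotientPrime R with
  | subsingleton N =>
    refine ⟨1, (Ideal.ne_top_iff_one p).mp hp.isPrime.ne_top, smul_abelianExt_eq_zero fun x ↦ ?_⟩
    exact Subsingleton.elim (α := N) _ _
  | quotient N q φ =>
    rw [φ.annihilator_eq, Ideal.annihilator_quotient] at hann
    by_cases hqp : q.asIdeal ≤ p
    · obtain rfl : q.asIdeal = p := le_antisymm hqp (hp.2 ⟨q.2, hann⟩ hqp)
      obtain ⟨s, hs, h⟩ := hq
      exact ⟨s, hs, smul_abelianExt_eq_zero_of_iso φ.toModuleIso h⟩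
    · obtain ⟨s, hsq, hsp⟩ := SetLike.not_le_iff_exists.mp hqp
      have hs : s ∈ Module.annihilator R N := by
        rwa [φ.annihilator_eq, Ideal.annihilator_quotient]
      exact ⟨s, hsp, smul_abelianExt_eq_zero (Module.mem_annihilator.mp hs)⟩
  | exact N₁ N₂ N₃ f g hf hg hfg h₁ h₃ =>
    obtain ⟨s, hs, hs'⟩ := h₁ (hann.trans (f.annihilator_le_of_injective hf))
    obtain ⟨t, ht, ht'⟩ := h₃ (hann.trans (g.annihilator_le_of_surjective hg))
    exact ⟨t * s, hp.isPrime.mul_notMem ht hs, smul_abelianExt_eq_zero_of_shortExact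
      (shortComplex_shortExact (shortComplexOfCompEqZero f g hfg.linearMap_comp_eq_zero)
        hfg hf hg) hs' ht'⟩

/-- If `Ext^{i+1}(B / A, T)` is killed by `s`, then `s` times any class in `Ext^i(A, T)` extends
to `B`. -/
theorem extLifts_of_injective {A B : Type u} [AddCommGroup A] [Module R A] [AddCommGroup B]
    [Module R B] {f : A →ₗ[R] B} (hf : Function.Injective f) {s : R} {T : ModuleCat.{u} R} {i : ℕ}
    (h : ∀ e : Abelian.Ext (of R (B ⧸ LinearMap.range f)) T (i + 1), s • e = 0) :
    ExtLifts (ofHom f) s T i :=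
  extLifts_of_shortExact (shortComplex_shortExact
    (shortComplexOfCompEqZero f _ f.exact_map_mkQ_range.linearMap_comp_eq_zero)
    f.exact_map_mkQ_range hf (Submodule.mkQ_surjective _)) h

/-- If `p` is a minimal prime of `I`, then `R / p` embeds into `R / I`. -/
theorem exists_injective_quotient_of_mem_minimalPrimes [IsNoetherianRing R] {I p : Ideal R}
    (hp : p ∈ I.minimalPrimes) : ∃ f : R ⧸ p →ₗ[R] R ⧸ I, Function.Injective f := by
  have h : p ∈ associatedPrimes R (R ⧸ I) :=
    Module.associatedPrimes.minimalPrimes_annihilator_subset_associatedPrimes R (R ⧸ I)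
      (by rwa [Ideal.annihilator_quotient])
  exact ((isAssociatedPrime_iff_exists_injective_linearMap p (R ⧸ I)).mp h).2

/-- Suppose `T` has finite injective dimension and `Ext^i(R / I, T)` vanishes for `i > c`. Then for
a minimal prime `p` of `I` and a finitely generated `R / I`-module `N`, the localization of
`Ext^i(N, T)` at `p` vanishes for `i > c`. -/
theorem exists_notMem_smul_abelianExt_eq_zero [IsNoetherianRing R] {I p : Ideal R}
    (hp : p ∈ I.minimalPrimes) {T : ModuleCat.{u} R} {n c : ℕ}
    (hT : ∀ (N : ModuleCat.{u} R) (i : ℕ), n < i → Subsingleton (Abelian.Ext N T i))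
    (hI : ∀ i, c < i → Subsingleton (Abelian.Ext (of R (R ⧸ I)) T i))
    (N : Type u) [AddCommGroup N] [Module R N] [Module.Finite R N]
    (hann : I ≤ Module.annihilator R N) {i : ℕ} (hi : c < i) :
    ∃ s ∉ p, ∀ e : Abelian.Ext (of R N) T i, s • e = 0 := by
  obtain ⟨k, hk⟩ : ∃ k, n < i + k := ⟨n + 1, by lia⟩
  induction k generalizing i N with
  | zero =>
    have := hT (of R N) i hk
    exact ⟨1, (Ideal.ne_top_iff_one p).mp hp.isPrime.ne_top, fun e ↦ Subsingleton.elim _ _⟩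
  | succ k ih =>
    refine exists_notMem_smul_abelianExt_eq_zero_of_quotient hp ?_ N hann
    obtain ⟨f, hf⟩ := exists_injective_quotient_of_mem_minimalPrimes hp
    obtain ⟨s, hs, h⟩ := ih ((R ⧸ I) ⧸ LinearMap.range f) (i := i + 1)
      ((Ideal.annihilator_quotient (I := I)).ge.trans
        ((LinearMap.range f).mkQ.annihilator_le_of_surjective (Submodule.mkQ_surjective _)))
      (by lia) (by lia)
    refine ⟨s, hs, fun e ↦ ?_⟩
    obtain ⟨y, hy⟩ := extLifts_of_injective hf h e
    have := hI i hi
    rw [← hy, Subsingleton.elim y 0, Abelian.Ext.comp_zero]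

theorem subsingleton_abelianExt_quotient_of_isRegular [IsNoetherianRing R] [IsLocalRing R]
    {rs : List R} (hrs : RingTheory.Sequence.IsRegular R rs) (T : ModuleCat.{u} R) {i : ℕ}
    (hi : rs.length < i) : Subsingleton (Abelian.Ext (of R (R ⧸ Ideal.ofList rs)) T i) := by
  have h := (projectiveDimension_le_iff _ _).mp
    (projectiveDimension_quotient_eq_length.{u} rs hrs).le
  have := h.subsingleton _ _ i hi T
  refine subsingleton_of_forall_eq 0 fun e ↦ ?_
  have h1 := smul_abelianExt_eq_zero_of_iso (s := (1 : R))
    (Shrink.linearEquiv R (R ⧸ Ideal.ofList rs)).symm.toModuleIso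
    (fun e ↦ Subsingleton.elim _ _) e
  rwa [one_smul] at h1

/-- Given an associated prime `p` of `M` that is minimal over an ideal generated by a regular
sequence killing `M`, a witness `x` of `p` is detected by a map `M → R / (rs)`. -/
theorem exists_linearMap_apply_ne_zero [IsNoetherianRing R] [IsLocalRing R]
    {n : ℕ} (hR : ∀ (N : ModuleCat.{u} R) (i : ℕ), n < i → Subsingleton (Abelian.Ext N (of R R) i))
    {rs : List R} (hrs : RingTheory.Sequence.IsRegular R rs) {p : Ideal R}
    (hp : p ∈ (Ideal.ofList rs).minimalPrimes) {M : Type u} [AddCommGroup M] [Module R M]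
    [Module.Finite R M] (hann : Ideal.ofList rs ≤ Module.annihilator R M)
    {f : R ⧸ p →ₗ[R] M} (hf : Function.Injective f) :
    ∃ g : M →ₗ[R] R ⧸ Ideal.ofList rs, g (f 1) ≠ 0 := by
  obtain ⟨s, hs, h⟩ := exists_notMem_smul_abelianExt_eq_zero hp hR
    (fun i ↦ subsingleton_abelianExt_quotient_of_isRegular hrs (of R R))
    (M ⧸ LinearMap.range f)
    (hann.trans ((LinearMap.range f).mkQ.annihilator_le_of_surjective (Submodule.mkQ_surjective _)))
    (Nat.lt_succ_self rs.length)
  have hM : ∀ r ∈ rs, ∀ x : M, r • x = 0 := fun r hr ↦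
    Module.mem_annihilator.mp (hann (Ideal.subset_span hr))
  obtain ⟨φ, hφ⟩ := exists_injective_quotient_of_mem_minimalPrimes hp
  have hlift := ((extLifts_of_injective hf h).quotient_ofList hrs.toIsWeaklyRegular
    (fun r hr x ↦ hf (by rw [map_smul, map_zero]; exact hM r hr _)) hM).of_iso
    (Submodule.quotEquivOfEq _ (Ideal.ofList rs)
      (by rw [smul_eq_mul, Ideal.mul_top])).toModuleIso
  obtain ⟨g, hg⟩ := hlift.exists_comp_eq_smul (ofHom φ)
  refine ⟨g.hom, fun h0 ↦ hs ?_⟩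
  have h1 : g.hom (f 1) = s • φ 1 := congrArg (fun k ↦ k.hom (1 : R ⧸ p)) hg
  rw [h0, ← map_smul] at h1
  have h2 : s • (1 : R ⧸ p) = 0 := hφ (h1.symm.trans (map_zero φ).symm)
  rwa [Algebra.smul_def, mul_one, Ideal.Quotient.algebraMap_eq,
    Ideal.Quotient.eq_zero_iff_mem] at h2

end ModuleCat

end

theorem WithBot.exists_natCast_of_add_eq_natCast {a : WithBot ℕ∞} {c n : ℕ} (h : a + c = n) :
    ∃ d : ℕ, a = d ∧ d + c = n := by
  induction a with
  | bot => exact absurd h WithBot.bot_ne_coe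
  | coe a =>
    replace h : a + c = n := WithBot.coe_injective h
    obtain ⟨d, rfl⟩ := ENat.ne_top_iff_exists.mp fun ha : a = ⊤ ↦
      ENat.natCast_ne_top n (by rw [← h, ha, top_add])
    exact ⟨d, rfl, by exact_mod_cast h⟩

theorem exists_ringKrullDim_eq_natCast (R : Type*) [CommRing R] [FiniteRingKrullDim R] :
    ∃ n : ℕ, ringKrullDim R = n := by
  obtain ⟨m, hm⟩ := WithBot.ne_bot_iff_exists.mp (ringKrullDim_ne_bot (R := R))
  obtain ⟨n, rfl⟩ := ENat.ne_top_iff_exists.mp fun h : m = ⊤ ↦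
    ringKrullDim_ne_top (R := R) (by rw [← hm, h]; rfl)
  exact ⟨n, hm.symm⟩

/-- If `M` is unmixed and killed by an ideal generated by a regular sequence of length `codim M`,
then every associated prime of `M` is minimal over that ideal. -/
theorem IsUnmixedMod.mem_minimalPrimes_ofList {R : Type} [CommRing R] [IsNoetherianRing R]
    [IsLocalRing R] {rs : List R} (hrs : RingTheory.Sequence.IsRegular R rs) {M : Type}
    [AddCommGroup M] [Module R M] [Module.Finite R M] (hM : IsUnmixedMod R M)
    (hann : Ideal.ofList rs ≤ Module.annihilator R M)
    (hc : mDim R M + (rs.length : WithBot (WithTop ℕ)) = ringKrullDim R) {p : Ideal R}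
    (hp : p ∈ associatedPrimes R M) : p ∈ (Ideal.ofList rs).minimalPrimes := by
  have := hp.isPrime
  obtain ⟨N, hN⟩ := exists_ringKrullDim_eq_natCast R
  obtain ⟨d, hd, hdN⟩ := WithBot.exists_natCast_of_add_eq_natCast (hc.trans hN)
  obtain ⟨q, hq, hqd⟩ := exists_minimalPrimes_height_add_le (Module.annihilator R M) d hd.ge
  have hqM := Module.associatedPrimes.minimalPrimes_annihilator_subset_associatedPrimes R M hq
  have hpq : p.height = q.height :=
    (PrimeSpectrum.height_eq_orderHeight (⟨p, hp.isPrime⟩ : PrimeSpectrum R)).trans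
      ((hM p q hp hqM).trans
        (PrimeSpectrum.height_eq_orderHeight (⟨q, hqM.isPrime⟩ : PrimeSpectrum R)).symm)
  have hple : p.height ≤ rs.length := by
    rw [hpq]
    rw [hN, ← hdN] at hqd
    have h : q.height + d ≤ rs.length + d := by
      rw [add_comm d] at hqd
      exact_mod_cast hqd
    exact (ENat.add_le_add_iff_right (ENat.natCast_ne_top d)).mp h
  refine Ideal.mem_minimalPrimes_of_height_le ?_
    (hple.trans (length_le_height_ofList rs hrs.toIsWeaklyRegular))
  refine hann.trans ?_
  rw [← Submodule.annihilator_top]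
  exact IsAssociatedPrime.annihilator_le hp

/-- Over a Gorenstein ring, for an unmixed finitely generated module `M`
of codimension `c`, the canonical homomorphism `M → K_{K_M}` is injective.  Via a complete
intersection `I = (f₁, …, f_c) ⊆ Ann M` and `S = R/I`, this map is identified with the
biduality map `M → Hom_S(Hom_S(M, S), S)`. -/
theorem unmixed_bidual_eval_injective
    (R : Type) [CommRing R] (hGor : IsGorensteinRing R)
    (c : ℕ) (rs : List R) (hreg : RingTheory.Sequence.IsRegular R rs)
    (hlen : rs.length = c) (I : Ideal R) (hI : I = Ideal.span {x | x ∈ rs})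
    (M : Type) [AddCommGroup M] [Module R M] [Module (R ⧸ I) M]
    [IsScalarTower R (R ⧸ I) M] [Module.Finite R M]
    (hann : I ≤ Module.annihilator R M)
    (hc : mDim R M + (c : WithBot (WithTop ℕ)) = ringKrullDim R)
    (hunmixed : IsUnmixedMod R M) :
    Function.Injective (Module.Dual.eval (R ⧸ I) M) := by
  obtain ⟨_, _, n, hn⟩ := hGor
  subst hlen hI
  change Ideal.ofList rs ≤ _ at hann
  have hR : ∀ (N : ModuleCat R) (i : ℕ), n < i →
      Subsingleton (Abelian.Ext N (ModuleCat.of R R) i) := by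
    intro N i hi
    obtain ⟨i, rfl⟩ := Nat.exists_eq_add_one_of_ne_zero (Nat.ne_zero_of_lt hi)
    exact subsingleton_abelianExt_of_subsingleton_ext (R := R) (hn N (i + 1) hi)
  by_contra hinj
  let K : Submodule R M :=
    (LinearMap.ker (Module.Dual.eval (R ⧸ Ideal.ofList rs) M)).restrictScalars R
  have hK : Nontrivial K := by
    rw [Submodule.nontrivial_iff_ne_bot]
    intro h
    exact hinj (LinearMap.ker_eq_bot.mp ((Submodule.restrictScalars_eq_bot_iff R _ M).mp h))
  obtain ⟨p, hp⟩ := associatedPrimes.nonempty R K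
  obtain ⟨-, f, hf⟩ := (isAssociatedPrime_iff_exists_injective_linearMap p K).mp hp
  have hpM : p ∈ associatedPrimes R M :=
    associatedPrimes.subset_of_injective K.subtype_injective hp
  have hpI := hunmixed.mem_minimalPrimes_ofList hreg hann hc hpM
  obtain ⟨g, hg⟩ := ModuleCat.exists_linearMap_apply_ne_zero hR hreg hpI hann
    (f := K.subtype ∘ₗ f) (K.subtype_injective.comp hf)
  let g' : Module.Dual (R ⧸ Ideal.ofList rs) M :=
    g.extendScalarsOfSurjective Ideal.Quotient.mk_surjective
  exact hg (LinearMap.congr_fun (LinearMap.mem_ker.mp (f 1).2) g')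
end

section
/- Let R be a Gorenstein ring and M a finitely generated R-module. Then M is a k-syzygy if and only if dim R/a_i(M) ≤ i - k for all i < dim R, where a_i(M) = Ann_R H^i_m(M). Moreover, for k ≥ 3 these conditions are equivalent to: M is reflexive and Ext^i_R(M^*, R) = 0 for 1 ≤ i ≤ k-2. -/
open CategoryTheory Opposite

/-- `M` is a `k`-syzygy: it embeds into a finitely generated free module with cokernel a
`(k-1)`-syzygy. -/
def IsKSyzygy (R : Type) [CommRing R] : ModuleCat R → ℕ → Prop
  | _, 0 => True
  | M, (k + 1) => ∃ F : ModuleCat R, Module.Free R F ∧ Module.Finite R F ∧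
      ∃ f : M →ₗ[R] F, Function.Injective f ∧
        IsKSyzygy R (ModuleCat.of R (F ⧸ LinearMap.range f)) k

section ExtComparison
variable {R : Type} [CommRing R]

/-- The map induced by a chain map on complexes of morphisms into a fixed object. -/
noncomputable def linearYonedaObjMap {P' P : ChainComplex (ModuleCat.{0} R) ℕ} (φ : P' ⟶ P)
    (Y : ModuleCat.{0} R) : P.linearYonedaObj R Y ⟶ P'.linearYonedaObj R Y :=
  (HomologicalComplex.unopFunctor _ _).map
    ((((linearYoneda R (ModuleCat R)).obj Y).rightOp.mapHomologicalComplex _).map φ).op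

theorem unop_square_of_iso {C : Type*} [Category C] {A A' : Cᵒᵖ} {B B' : C} (a : A ≅ op B)
    (a' : A' ≅ op B') (f : A' ⟶ A) (g : B ⟶ B') (h : f ≫ a.hom = a'.hom ≫ g.op) :
    f.unop ≫ a'.inv.unop = a.inv.unop ≫ g := by
  apply Quiver.Hom.op_inj
  simp only [op_comp, Quiver.Hom.op_unop]
  rw [Iso.inv_comp_eq, ← Category.assoc, ← h, Category.assoc, Iso.hom_inv_id, Category.comp_id]

theorem comp_square {C : Type*} [Category C] {A B D A' B' D' : C} (u : A ⟶ A') (v : B ⟶ B')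
    (w : D ⟶ D') (f : A ⟶ B) (g : B ⟶ D) (f' : A' ⟶ B') (g' : B' ⟶ D')
    (h : u ≫ f' = f ≫ v) (h' : v ≫ g' = g ≫ w) : u ≫ f' ≫ g' = (f ≫ g) ≫ w := by
  rw [← Category.assoc, h, Category.assoc, h', Category.assoc]

theorem isoExt_hom_naturality {Y X X' : ModuleCat.{0} R} (n : ℕ) (g : X' ⟶ X)
    (P' : ProjectiveResolution X') (P : ProjectiveResolution X)
    (φ : ProjectiveResolution.Hom P' P g) :
    ((Ext R (ModuleCat R) n).map g.op).app Y ≫ (P'.isoExt n Y).hom =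
      (P.isoExt n Y).hom ≫ HomologicalComplex.homologyMap (linearYonedaObjMap φ.hom Y) n := by
  have h := congrArg Quiver.Hom.unop (ProjectiveResolution.isoLeftDerivedObj_inv_naturality g P' P
    φ.hom φ.hom_f_zero_comp_π_f_zero ((linearYoneda R (ModuleCat R)).obj Y).rightOp n)
  have h2 := HomologicalComplex.homologyOp_hom_naturality (linearYonedaObjMap φ.hom Y) n
  exact comp_square _ _ _ _ _ _ _ h (unop_square_of_iso
    (HomologicalComplex.homologyOp (P.complex.linearYonedaObj R Y) n)
    (HomologicalComplex.homologyOp (P'.complex.linearYonedaObj R Y) n) _ _ h2)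

open HomologicalComplex

theorem ProjectiveResolution.extMk_eq_zero_of_degree_zero {X Y : ModuleCat.{0} R}
    (P : ProjectiveResolution X) (f : P.complex.X 0 ⟶ Y) (hf : P.complex.d 1 0 ≫ f = 0)
    (h : P.extMk f 1 rfl hf = 0) : f = 0 := by
  rw [← P.extEquivCohomologyClass.apply_eq_iff_eq,
    ProjectiveResolution.extEquivCohomologyClass_extMk,
    ProjectiveResolution.extEquivCohomologyClass_zero,
    CochainComplex.HomComplex.CohomologyClass.mk_eq_zero_iff,
    CochainComplex.HomComplex.Cocycle.toSingleMk_mem_coboundaries_iff _ _ _ _ _ 1 (by simp)] at h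
  obtain ⟨g, hg⟩ := h
  have : g = 0 := (CochainComplex.isZero_of_isStrictlyLE P.cochainComplex 0 1
    (by norm_num)).eq_of_src _ _
  rw [this, Limits.comp_zero] at hg
  rw [← cancel_epi (P.cochainComplexXIso (-((0 : ℕ) : ℤ)) 0 rfl).hom, ← hg, Limits.comp_zero]

theorem linearYonedaObj_d_iCycles {X Y : ModuleCat.{0} R} (P : ProjectiveResolution X) (n : ℕ)
    (z : (P.complex.linearYonedaObj R Y).cycles n) :
    P.complex.d (n + 1) n ≫
      (((P.complex.linearYonedaObj R Y).iCycles n).hom z : P.complex.X n ⟶ Y) = 0 := by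
  exact LinearMap.congr_fun (congrArg ModuleCat.Hom.hom
    ((P.complex.linearYonedaObj R Y).iCycles_d n (n + 1))) z

theorem ProjectiveResolution.extMk_congr {X Y : ModuleCat.{0} R} (P : ProjectiveResolution X)
    {n : ℕ} {f g : P.complex.X n ⟶ Y} (h : f = g) (hf : P.complex.d (n + 1) n ≫ f = 0)
    (hg : P.complex.d (n + 1) n ≫ g = 0) :
    P.extMk f (n + 1) rfl hf = P.extMk g (n + 1) rfl hg := by
  subst h
  rfl

theorem ProjectiveResolution.extMk_smul {X Y : ModuleCat.{0} R} (P : ProjectiveResolution X)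
    {n : ℕ} (r : R) (f : P.complex.X n ⟶ Y) (hf : P.complex.d (n + 1) n ≫ f = 0) :
    P.extMk (r • f) (n + 1) rfl (by rw [Linear.comp_smul, hf, smul_zero]) =
      r • P.extMk f (n + 1) rfl hf := by
  rw [Abelian.Ext.smul_eq_comp_mk₀, ProjectiveResolution.extMk_comp_mk₀]
  simp

/-- The class in `Ext` of a cocycle. -/
noncomputable def extOfCycle {X : ModuleCat.{0} R} (P : ProjectiveResolution X)
    (Y : ModuleCat.{0} R) (n : ℕ) :
    (P.complex.linearYonedaObj R Y).cycles n →ₗ[R] Abelian.Ext X Y n where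
  toFun z := P.extMk (((P.complex.linearYonedaObj R Y).iCycles n).hom z) (n + 1) rfl
    (linearYonedaObj_d_iCycles P n z)
  map_add' z w := by
    refine Eq.trans ?_ (P.add_extMk _ _ (n + 1) rfl (linearYonedaObj_d_iCycles P n z)
      (linearYonedaObj_d_iCycles P n w)).symm
    exact ProjectiveResolution.extMk_congr _
      (map_add ((P.complex.linearYonedaObj R Y).iCycles n).hom z w) _ _
  map_smul' r z := by
    refine Eq.trans ?_ (ProjectiveResolution.extMk_smul P r _ (linearYonedaObj_d_iCycles P n z))
    exact ProjectiveResolution.extMk_congr _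
      (map_smul ((P.complex.linearYonedaObj R Y).iCycles n).hom r z) _ _

theorem linearYonedaObj_exists_cycle {X Y : ModuleCat.{0} R} (P : ProjectiveResolution X) (n : ℕ)
    (f : P.complex.X n ⟶ Y) (hf : P.complex.d (n + 1) n ≫ f = 0) :
    ∃ z : (P.complex.linearYonedaObj R Y).cycles n,
      ((P.complex.linearYonedaObj R Y).iCycles n).hom z = f := by
  let K := P.complex.linearYonedaObj R Y
  have hex : (ShortComplex.mk (K.iCycles n) (K.d n (n + 1)) (K.iCycles_d n (n + 1))).Exact :=
    ShortComplex.exact_of_f_is_kernel _ (K.cyclesIsKernel n (n + 1) (by simp))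
  exact (ShortComplex.moduleCat_exact_iff _).1 hex f hf

theorem extOfCycle_surjective {X : ModuleCat.{0} R} (P : ProjectiveResolution X)
    (Y : ModuleCat.{0} R) (n : ℕ) : Function.Surjective (extOfCycle P Y n) := by
  intro α
  obtain ⟨f, hf, rfl⟩ := P.extMk_surjective α (n + 1) rfl
  obtain ⟨z, hz⟩ := linearYonedaObj_exists_cycle P n f hf
  refine ⟨z, ?_⟩
  subst hz
  rfl

theorem ker_extOfCycle {X : ModuleCat.{0} R} (P : ProjectiveResolution X)
    (Y : ModuleCat.{0} R) (n : ℕ) : LinearMap.ker (extOfCycle P Y n) =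
      LinearMap.ker ((P.complex.linearYonedaObj R Y).homologyπ n).hom := by
  ext z
  let K := P.complex.linearYonedaObj R Y
  have hmono : Function.Injective (K.iCycles n).hom :=
    (ModuleCat.mono_iff_injective (K.iCycles n)).1 inferInstance
  simp only [LinearMap.mem_ker]
  cases n with
  | zero =>
    constructor
    · intro h
      have := ProjectiveResolution.extMk_eq_zero_of_degree_zero P _
        (linearYonedaObj_d_iCycles P 0 z) h
      have hz : z = 0 := hmono (this.trans (map_zero _).symm)
      rw [hz, map_zero]
    · intro h
      have hex : (ShortComplex.mk (K.toCycles 0 0) (K.homologyπ 0)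
          (K.toCycles_comp_homologyπ 0 0)).Exact :=
        ShortComplex.exact_of_g_is_cokernel _ (K.homologyIsCokernel 0 0 (by simp))
      obtain ⟨y, hy⟩ := (ShortComplex.moduleCat_exact_iff _).1 hex z h
      have h0 : K.toCycles 0 0 = 0 := by
        rw [← cancel_mono (K.iCycles 0), Limits.zero_comp, toCycles_i]
        exact K.shape _ _ (by simp)
      have : z = 0 := hy.symm.trans
        (LinearMap.congr_fun (congrArg ModuleCat.Hom.hom h0) y)
      rw [this, map_zero]
  | succ p =>
    refine (P.extMk_eq_zero_iff _ (p + 1 + 1) rfl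
      (linearYonedaObj_d_iCycles P (p + 1) z) p rfl).trans ?_
    have hex : (ShortComplex.mk (K.toCycles p (p + 1)) (K.homologyπ (p + 1))
        (K.toCycles_comp_homologyπ p (p + 1))).Exact :=
      ShortComplex.exact_of_g_is_cokernel _ (K.homologyIsCokernel p (p + 1) (by simp))
    have hi : ∀ y, (K.iCycles (p + 1)).hom ((K.toCycles p (p + 1)).hom y) =
        (K.d p (p + 1)).hom y := fun y =>
      LinearMap.congr_fun (congrArg ModuleCat.Hom.hom (K.toCycles_i p (p + 1))) y
    constructor
    · rintro ⟨g, hg⟩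
      have : (K.toCycles p (p + 1)).hom g = z := hmono ((hi g).trans hg)
      rw [← this]
      exact LinearMap.congr_fun (congrArg ModuleCat.Hom.hom
        (K.toCycles_comp_homologyπ p (p + 1))) g
    · intro h
      obtain ⟨y, hy⟩ := (ShortComplex.moduleCat_exact_iff _).1 hex z h
      exact ⟨y, (hi y).symm.trans (congrArg _ hy)⟩

theorem extOfCycle_naturality {X X' : ModuleCat.{0} R} {g : X' ⟶ X} (P' : ProjectiveResolution X')
    (P : ProjectiveResolution X) (φ : ProjectiveResolution.Hom P' P g)
    (Y : ModuleCat.{0} R) (n : ℕ) (z : (P.complex.linearYonedaObj R Y).cycles n) :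
    (Abelian.Ext.mk₀ g).comp (extOfCycle P Y n z) (zero_add n) =
      extOfCycle P' Y n ((cyclesMap (linearYonedaObjMap φ.hom Y) n).hom z) := by
  refine (ProjectiveResolution.mk₀_comp_extMk _ (n + 1) rfl
    (linearYonedaObj_d_iCycles P n z) φ).trans ?_
  exact ProjectiveResolution.extMk_congr _ (LinearMap.congr_fun (congrArg ModuleCat.Hom.hom
    (cyclesMap_i (linearYonedaObjMap φ.hom Y) n)) z).symm _
    (linearYonedaObj_d_iCycles P' n _)

theorem exists_linearEquiv_of_ker_eq {A B C : Type*} [AddCommGroup A] [AddCommGroup B]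
    [AddCommGroup C] [Module R A] [Module R B] [Module R C] (f : A →ₗ[R] B) (g : A →ₗ[R] C)
    (hf : Function.Surjective f) (hg : Function.Surjective g)
    (h : LinearMap.ker g = LinearMap.ker f) : ∃ e : B ≃ₗ[R] C, ∀ a, e (f a) = g a := by
  refine ⟨(f.quotKerEquivOfSurjective hf).symm ≪≫ₗ Submodule.quotEquivOfEq _ _ h.symm ≪≫ₗ
    g.quotKerEquivOfSurjective hg, fun a => ?_⟩
  have h2 : (f.quotKerEquivOfSurjective hf).symm (f a) = Submodule.Quotient.mk a := by
    rw [LinearEquiv.symm_apply_eq]; rfl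
  simp only [LinearEquiv.trans_apply, h2]
  rfl

theorem exists_linearEquiv_homology_ext (X Y : ModuleCat.{0} R) (n : ℕ)
    (P : ProjectiveResolution X) :
    ∃ e : (P.complex.linearYonedaObj R Y).homology n ≃ₗ[R] Abelian.Ext X Y n,
      ∀ z, e (((P.complex.linearYonedaObj R Y).homologyπ n).hom z) = extOfCycle P Y n z :=
  exists_linearEquiv_of_ker_eq _ _
    ((ModuleCat.epi_iff_surjective ((P.complex.linearYonedaObj R Y).homologyπ n)).1 inferInstance)
    (extOfCycle_surjective P Y n) (ker_extOfCycle P Y n)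

theorem exists_linearEquiv_ext (X Y : ModuleCat.{0} R) (n : ℕ) (P : ProjectiveResolution X) :
    ∃ e : ((Ext R (ModuleCat R) n).obj (op X)).obj Y ≃ₗ[R] Abelian.Ext X Y n,
      ∀ z x, (P.isoExt n Y).hom.hom x = ((P.complex.linearYonedaObj R Y).homologyπ n).hom z →
        e x = extOfCycle P Y n z := by
  obtain ⟨e, he⟩ := exists_linearEquiv_homology_ext X Y n P
  exact ⟨(P.isoExt n Y).toLinearEquiv.trans e, fun z x hx => (congrArg e hx).trans (he z)⟩

/-- The two versions of `Ext` agree, naturally in the first variable. -/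
theorem exists_natural_linearEquiv_ext (Y : ModuleCat.{0} R) (n : ℕ) :
    ∃ e : ∀ X : ModuleCat.{0} R,
      ((Ext R (ModuleCat R) n).obj (op X)).obj Y ≃ₗ[R] Abelian.Ext X Y n,
      ∀ (X' X : ModuleCat.{0} R) (g : X' ⟶ X) (x : ((Ext R (ModuleCat R) n).obj (op X)).obj Y),
        e X' ((((Ext R (ModuleCat R) n).map g.op).app Y).hom x) =
          (Abelian.Ext.mk₀ g).comp (e X x) (zero_add n) := by
  choose e he using fun X => exists_linearEquiv_ext X Y n (projectiveResolution X)
  refine ⟨e, fun X' X g x => ?_⟩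
  let P := projectiveResolution X
  let P' := projectiveResolution X'
  let φ : ProjectiveResolution.Hom P' P g :=
    ⟨ProjectiveResolution.lift g P' P, ProjectiveResolution.lift_commutes_zero g P' P⟩
  have hs : Function.Surjective ((P.complex.linearYonedaObj R Y).homologyπ n).hom :=
    (ModuleCat.epi_iff_surjective ((P.complex.linearYonedaObj R Y).homologyπ n)).1 inferInstance
  obtain ⟨z, hz⟩ := hs ((P.isoExt n Y).hom.hom x)
  have hnat : (P'.isoExt n Y).hom.hom ((((Ext R (ModuleCat R) n).map g.op).app Y).hom x) =
      ((P'.complex.linearYonedaObj R Y).homologyπ n).hom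
        ((cyclesMap (linearYonedaObjMap φ.hom Y) n).hom z) := by
    have h1 := LinearMap.congr_fun (congrArg ModuleCat.Hom.hom
      (isoExt_hom_naturality (Y := Y) n g P' P φ)) x
    have h2 := LinearMap.congr_fun (congrArg ModuleCat.Hom.hom
      (homologyπ_naturality (linearYonedaObjMap φ.hom Y) n)) z
    exact (h1.trans
      (congrArg (homologyMap (linearYonedaObjMap φ.hom Y) n).hom hz.symm)).trans h2
  rw [he X' _ _ hnat, ← extOfCycle_naturality P' P φ]
  exact congrArg (fun y => (Abelian.Ext.mk₀ g).comp y (zero_add n)) (he X z x hz.symm).symm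
end ExtComparison

section ModExtBasic

/-- The module `Ext^i_R(A, B)` for unbundled modules. -/
def ModExt (R : Type) [CommRing R] (A B : Type) [AddCommGroup A] [Module R A] [AddCommGroup B]
    [Module R B] (i : ℕ) : Type :=
  Abelian.Ext (ModuleCat.of R A) (ModuleCat.of R B) i

noncomputable instance (R : Type) [CommRing R] (A B : Type) [AddCommGroup A] [Module R A]
    [AddCommGroup B] [Module R B] (i : ℕ) : AddCommGroup (ModExt R A B i) :=
  inferInstanceAs (AddCommGroup (Abelian.Ext (ModuleCat.of R A) (ModuleCat.of R B) i))

noncomputable instance (R : Type) [CommRing R] (A B : Type) [AddCommGroup A] [Module R A]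
    [AddCommGroup B] [Module R B] (i : ℕ) : Module R (ModExt R A B i) :=
  inferInstanceAs (Module R (Abelian.Ext (ModuleCat.of R A) (ModuleCat.of R B) i))

variable {R : Type} [CommRing R]
variable {A A' A'' B B' B'' C C' : Type}
  [AddCommGroup A] [Module R A] [AddCommGroup A'] [Module R A'] [AddCommGroup A''] [Module R A'']
  [AddCommGroup B] [Module R B] [AddCommGroup B'] [Module R B'] [AddCommGroup B''] [Module R B'']
  [AddCommGroup C] [Module R C] [AddCommGroup C'] [Module R C']

namespace ModExt

/-- Pullback of `Ext` along a map of the first argument. -/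
noncomputable def pull (f : A →ₗ[R] A') (B : Type) [AddCommGroup B] [Module R B] (i : ℕ) :
    ModExt R A' B i →ₗ[R] ModExt R A B i :=
  (Abelian.Ext.mk₀ (ModuleCat.ofHom f)).precompOfLinear R (ModuleCat.of R B) (zero_add i)

/-- Pushforward of `Ext` along a map of the second argument. -/
noncomputable def push (A : Type) [AddCommGroup A] [Module R A] (g : B →ₗ[R] B') (i : ℕ) :
    ModExt R A B i →ₗ[R] ModExt R A B' i :=
  (Abelian.Ext.mk₀ (ModuleCat.ofHom g)).postcompOfLinear R (ModuleCat.of R A) (add_zero i)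

theorem pull_id (i : ℕ) (ξ : ModExt R A B i) : pull (LinearMap.id : A →ₗ[R] A) B i ξ = ξ :=
  Abelian.Ext.mk₀_id_comp _

theorem push_id (i : ℕ) (ξ : ModExt R A B i) : push A (LinearMap.id : B →ₗ[R] B) i ξ = ξ :=
  Abelian.Ext.comp_mk₀_id _

theorem pull_comp (f : A →ₗ[R] A') (f' : A' →ₗ[R] A'') (i : ℕ) (ξ : ModExt R A'' B i) :
    pull (f' ∘ₗ f) B i ξ = pull f B i (pull f' B i ξ) := by
  refine Eq.trans ?_ (Abelian.Ext.mk₀_comp_mk₀_assoc (ModuleCat.ofHom f) (ModuleCat.ofHom f')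
    (show Abelian.Ext (ModuleCat.of R A'') (ModuleCat.of R B) i from ξ)).symm
  rfl

theorem push_comp (g : B →ₗ[R] B') (g' : B' →ₗ[R] B'') (i : ℕ) (ξ : ModExt R A B i) :
    push A (g' ∘ₗ g) i ξ = push A g' i (push A g i ξ) := by
  refine Eq.trans ?_ (Abelian.Ext.comp_assoc
    (show Abelian.Ext (ModuleCat.of R A) (ModuleCat.of R B) i from ξ)
    (Abelian.Ext.mk₀ (ModuleCat.ofHom g)) (Abelian.Ext.mk₀ (ModuleCat.ofHom g'))
    (add_zero i) (add_zero 0) (by lia)).symm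
  rw [Abelian.Ext.mk₀_comp_mk₀]
  rfl

theorem push_pull (f : A →ₗ[R] A') (g : B →ₗ[R] B') (i : ℕ) (ξ : ModExt R A' B i) :
    push A g i (pull f B i ξ) = pull f B' i (push A' g i ξ) :=
  Abelian.Ext.comp_assoc (Abelian.Ext.mk₀ (ModuleCat.ofHom f))
    (show Abelian.Ext (ModuleCat.of R A') (ModuleCat.of R B) i from ξ)
    (Abelian.Ext.mk₀ (ModuleCat.ofHom g)) (zero_add i) (add_zero i) (by lia)

theorem pull_add (f g : A →ₗ[R] A') (i : ℕ) (ξ : ModExt R A' B i) :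
    pull (f + g) B i ξ = pull f B i ξ + pull g B i ξ := by
  let ξ' : Abelian.Ext (ModuleCat.of R A') (ModuleCat.of R B) i := ξ
  exact (congrArg (fun y => Abelian.Ext.comp y ξ' (zero_add i))
    (Abelian.Ext.mk₀_add (ModuleCat.ofHom f) (ModuleCat.ofHom g))).trans
      (Abelian.Ext.add_comp _ _ _ _)

theorem push_add (f g : B →ₗ[R] B') (i : ℕ) (ξ : ModExt R A B i) :
    push A (f + g) i ξ = push A f i ξ + push A g i ξ := by
  let ξ' : Abelian.Ext (ModuleCat.of R A) (ModuleCat.of R B) i := ξ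
  exact (congrArg (fun y => Abelian.Ext.comp ξ' y (add_zero i))
    (Abelian.Ext.mk₀_add (ModuleCat.ofHom f) (ModuleCat.ofHom g))).trans
      (Abelian.Ext.comp_add _ _ _ _)

theorem pull_smul (x : R) (f : A →ₗ[R] A') (i : ℕ) (ξ : ModExt R A' B i) :
    pull (x • f) B i ξ = x • pull f B i ξ := by
  let ξ' : Abelian.Ext (ModuleCat.of R A') (ModuleCat.of R B) i := ξ
  exact (congrArg (fun y => Abelian.Ext.comp y ξ' (zero_add i))
    (Abelian.Ext.mk₀_smul x (ModuleCat.ofHom f))).trans (Abelian.Ext.smul_comp _ _ _ _)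

theorem push_smul (x : R) (f : B →ₗ[R] B') (i : ℕ) (ξ : ModExt R A B i) :
    push A (x • f) i ξ = x • push A f i ξ := by
  let ξ' : Abelian.Ext (ModuleCat.of R A) (ModuleCat.of R B) i := ξ
  exact (congrArg (fun y => Abelian.Ext.comp ξ' y (add_zero i))
    (Abelian.Ext.mk₀_smul x (ModuleCat.ofHom f))).trans (Abelian.Ext.comp_smul _ _ _ _)

theorem pull_zero (i : ℕ) (ξ : ModExt R A' B i) : pull (0 : A →ₗ[R] A') B i ξ = 0 := by
  have := pull_smul (0 : R) (0 : A →ₗ[R] A') i ξ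
  rwa [zero_smul, zero_smul] at this

theorem push_zero (i : ℕ) (ξ : ModExt R A B i) : push A (0 : B →ₗ[R] B') i ξ = 0 := by
  have := push_smul (0 : R) (0 : B →ₗ[R] B') i ξ
  rwa [zero_smul, zero_smul] at this

theorem smul_eq_pull (x : R) (i : ℕ) (ξ : ModExt R A B i) :
    x • ξ = pull (x • LinearMap.id : A →ₗ[R] A) B i ξ := by
  rw [pull_smul, pull_id]

theorem smul_eq_push (x : R) (i : ℕ) (ξ : ModExt R A B i) :
    x • ξ = push A (x • LinearMap.id : B →ₗ[R] B) i ξ := by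
  rw [push_smul, push_id]

theorem smul_eq_zero_of_left (x : R) (h : ∀ a : A, x • a = 0) (i : ℕ) (ξ : ModExt R A B i) :
    x • ξ = 0 := by
  rw [smul_eq_pull, show (x • LinearMap.id : A →ₗ[R] A) = 0 from LinearMap.ext h, pull_zero]

theorem smul_eq_zero_of_right (x : R) (h : ∀ b : B, x • b = 0) (i : ℕ) (ξ : ModExt R A B i) :
    x • ξ = 0 := by
  rw [smul_eq_push, show (x • LinearMap.id : B →ₗ[R] B) = 0 from LinearMap.ext h, push_zero]

/-- Degree zero `Ext` is the module of linear maps. -/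
noncomputable def zeroEquiv (R : Type) [CommRing R] (A B : Type) [AddCommGroup A] [Module R A]
    [AddCommGroup B] [Module R B] : ModExt R A B 0 ≃ₗ[R] (A →ₗ[R] B) :=
  (Abelian.Ext.linearEquiv₀ (R := R) (X := ModuleCat.of R A) (Y := ModuleCat.of R B)).trans
    (ModuleCat.homLinearEquiv (S := R))

theorem zeroEquiv_symm_apply (h : A →ₗ[R] B) :
    (zeroEquiv R A B).symm h = Abelian.Ext.mk₀ (ModuleCat.ofHom h) := rfl

theorem pull_zeroEquiv_symm (f : A →ₗ[R] A') (h : A' →ₗ[R] B) :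
    pull f B 0 ((zeroEquiv R A' B).symm h) = (zeroEquiv R A B).symm (h ∘ₗ f) := by
  rw [zeroEquiv_symm_apply, zeroEquiv_symm_apply]
  exact Abelian.Ext.mk₀_comp_mk₀ _ _

theorem zeroEquiv_pull (f : A →ₗ[R] A') (ξ : ModExt R A' B 0) :
    zeroEquiv R A B (pull f B 0 ξ) = zeroEquiv R A' B ξ ∘ₗ f := by
  obtain ⟨h, rfl⟩ := (zeroEquiv R A' B).symm.surjective ξ
  rw [pull_zeroEquiv_symm, LinearEquiv.apply_symm_apply, LinearEquiv.apply_symm_apply]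

theorem eq_zero_of_free [Module.Free R A] (i : ℕ) (ξ : ModExt R A B (i + 1)) : ξ = 0 := by
  have : Projective (ModuleCat.of R A) := ModuleCat.projective_of_free (Module.Free.chooseBasis R A)
  exact Abelian.Ext.eq_zero_of_projective _

instance finite [IsNoetherianRing R] [Module.Finite R A] [Module.Finite R B] (i : ℕ) :
    Module.Finite R (ModExt R A B i) :=
  inferInstanceAs (Module.Finite R (Abelian.Ext (ModuleCat.of R A) (ModuleCat.of R B) i))

end ModExt

/-- The short complex attached to a short exact sequence of modules. -/
def IsSES.shortComplex {f : A →ₗ[R] B} {g : B →ₗ[R] C} (h : IsSES R f g) :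
    ShortComplex (ModuleCat.{0} R) :=
  ShortComplex.mk (ModuleCat.ofHom f) (ModuleCat.ofHom g) (by
    ext x
    exact h.2.2.apply_apply_eq_zero x)

theorem IsSES.shortExact {f : A →ₗ[R] B} {g : B →ₗ[R] C} (h : IsSES R f g) :
    h.shortComplex.ShortExact where
  exact := ModuleCat.shortComplex_exact _ h.2.2
  mono_f := (ModuleCat.mono_iff_injective _).2 h.1
  epi_g := (ModuleCat.epi_iff_surjective _).2 h.2.1

/-- A map of short exact sequences. -/
def IsSES.shortComplexHom {f : A →ₗ[R] B} {g : B →ₗ[R] C} (h : IsSES R f g)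
    {f' : A' →ₗ[R] B'} {g' : B' →ₗ[R] C'} (h' : IsSES R f' g') (a : A →ₗ[R] A') (b : B →ₗ[R] B')
    (c : C →ₗ[R] C') (hab : b ∘ₗ f = f' ∘ₗ a) (hbc : c ∘ₗ g = g' ∘ₗ b) :
    h.shortComplex ⟶ h'.shortComplex where
  τ₁ := ModuleCat.ofHom a
  τ₂ := ModuleCat.ofHom b
  τ₃ := ModuleCat.ofHom c
  comm₁₂ := ModuleCat.hom_ext hab.symm
  comm₂₃ := ModuleCat.hom_ext hbc.symm

namespace ModExt

/-- The connecting map in the first variable. -/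
noncomputable def conn {f : A →ₗ[R] B} {g : B →ₗ[R] C} (h : IsSES R f g) (Y : Type)
    [AddCommGroup Y] [Module R Y] (i : ℕ) : ModExt R A Y i →ₗ[R] ModExt R C Y (i + 1) :=
  h.shortExact.extClass.precompOfLinear R (ModuleCat.of R Y) (add_comm 1 i)

/-- The connecting map in the second variable. -/
noncomputable def coconn {f : A →ₗ[R] B} {g : B →ₗ[R] C} (h : IsSES R f g) (X : Type)
    [AddCommGroup X] [Module R X] (i : ℕ) : ModExt R X C i →ₗ[R] ModExt R X A (i + 1) :=
  h.shortExact.extClass.postcompOfLinear R (ModuleCat.of R X) rfl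

variable {X X' Y Y' : Type} [AddCommGroup X] [Module R X] [AddCommGroup X'] [Module R X']
  [AddCommGroup Y] [Module R Y] [AddCommGroup Y'] [Module R Y']

theorem pull_pull_eq_zero {f : A →ₗ[R] B} {g : B →ₗ[R] C} (h : IsSES R f g) {i : ℕ}
    (ξ : ModExt R C Y i) : pull f Y i (pull g Y i ξ) = 0 := by
  rw [← pull_comp, h.2.2.linearMap_comp_eq_zero, pull_zero]

theorem push_push_eq_zero {f : A →ₗ[R] B} {g : B →ₗ[R] C} (h : IsSES R f g) {i : ℕ}
    (ξ : ModExt R X A i) : push X g i (push X f i ξ) = 0 := by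
  rw [← push_comp, h.2.2.linearMap_comp_eq_zero, push_zero]

theorem exists_pull_eq {f : A →ₗ[R] B} {g : B →ₗ[R] C} (h : IsSES R f g) {i : ℕ}
    (ξ : ModExt R B Y i) (hξ : pull f Y i ξ = 0) : ∃ η, pull g Y i η = ξ :=
  Abelian.Ext.contravariant_sequence_exact₂ h.shortExact _ ξ hξ

theorem exists_push_eq {f : A →ₗ[R] B} {g : B →ₗ[R] C} (h : IsSES R f g) {i : ℕ}
    (ξ : ModExt R X B i) (hξ : push X g i ξ = 0) : ∃ η, push X f i η = ξ :=
  Abelian.Ext.covariant_sequence_exact₂ _ h.shortExact ξ hξ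

theorem exists_pull_eq_of_conn {f : A →ₗ[R] B} {g : B →ₗ[R] C} (h : IsSES R f g) {i : ℕ}
    (ξ : ModExt R A Y i) (hξ : conn h Y i ξ = 0) : ∃ η, pull f Y i η = ξ :=
  Abelian.Ext.contravariant_sequence_exact₁ h.shortExact _ ξ (add_comm 1 i) hξ

theorem exists_push_eq_of_coconn {f : A →ₗ[R] B} {g : B →ₗ[R] C} (h : IsSES R f g) {i : ℕ}
    (ξ : ModExt R X C i) (hξ : coconn h X i ξ = 0) : ∃ η, push X g i η = ξ :=
  Abelian.Ext.covariant_sequence_exact₃ _ h.shortExact ξ rfl hξ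

theorem exists_conn_eq {f : A →ₗ[R] B} {g : B →ₗ[R] C} (h : IsSES R f g) {i : ℕ}
    (ξ : ModExt R C Y (i + 1)) (hξ : pull g Y (i + 1) ξ = 0) : ∃ η, conn h Y i η = ξ :=
  Abelian.Ext.contravariant_sequence_exact₃ h.shortExact _ ξ hξ (add_comm 1 i)

theorem exists_coconn_eq {f : A →ₗ[R] B} {g : B →ₗ[R] C} (h : IsSES R f g) {i : ℕ}
    (ξ : ModExt R X A (i + 1)) (hξ : push X f (i + 1) ξ = 0) : ∃ η, coconn h X i η = ξ :=
  Abelian.Ext.covariant_sequence_exact₁ _ h.shortExact ξ hξ rfl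

theorem conn_pull {f : A →ₗ[R] B} {g : B →ₗ[R] C} (h : IsSES R f g) {i : ℕ}
    (ξ : ModExt R B Y i) : conn h Y i (pull f Y i ξ) = 0 :=
  h.shortExact.extClass_comp_assoc
    (show Abelian.Ext (ModuleCat.of R B) (ModuleCat.of R Y) i from ξ)
    (h := add_comm 1 i)

theorem push_coconn {f : A →ₗ[R] B} {g : B →ₗ[R] C} (h : IsSES R f g) {i : ℕ}
    (ξ : ModExt R X C i) : push X f (i + 1) (coconn h X i ξ) = 0 := by
  refine (Abelian.Ext.comp_assoc
    (show Abelian.Ext (ModuleCat.of R X) (ModuleCat.of R C) i from ξ)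
    h.shortExact.extClass (Abelian.Ext.mk₀ (ModuleCat.ofHom f))
    rfl (add_zero 1) (by lia)).trans ?_
  exact (congrArg (fun y => Abelian.Ext.comp
    (show Abelian.Ext (ModuleCat.of R X) (ModuleCat.of R C) i from ξ) y rfl)
    h.shortExact.extClass_comp).trans (Abelian.Ext.comp_zero _ _ _ _ _)

theorem coconn_pull {f : A →ₗ[R] B} {g : B →ₗ[R] C} (h : IsSES R f g) {i : ℕ} (k : X →ₗ[R] X')
    (ξ : ModExt R X' C i) :
    coconn h X i (pull k C i ξ) = pull k A (i + 1) (coconn h X' i ξ) :=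
  Abelian.Ext.comp_assoc (Abelian.Ext.mk₀ (ModuleCat.ofHom k))
    (show Abelian.Ext (ModuleCat.of R X') (ModuleCat.of R C) i from ξ)
    h.shortExact.extClass (zero_add i) rfl (by lia)

theorem pull_conn_naturality {f : A →ₗ[R] B} {g : B →ₗ[R] C} (h : IsSES R f g)
    {f' : A' →ₗ[R] B'} {g' : B' →ₗ[R] C'} (h' : IsSES R f' g') (a : A →ₗ[R] A') (b : B →ₗ[R] B')
    (c : C →ₗ[R] C') (hab : b ∘ₗ f = f' ∘ₗ a) (hbc : c ∘ₗ g = g' ∘ₗ b) {i : ℕ}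
    (ξ : ModExt R A' Y i) :
    pull c Y (i + 1) (conn h' Y i ξ) = conn h Y i (pull a Y i ξ) := by
  have hn := ShortComplex.ShortExact.extClass_naturality h.shortExact h'.shortExact
    (h.shortComplexHom h' a b c hab hbc)
  let ξ' : Abelian.Ext (ModuleCat.of R A') (ModuleCat.of R Y) i := ξ
  have h1 := Abelian.Ext.comp_assoc (Abelian.Ext.mk₀ (ModuleCat.ofHom c))
    h'.shortExact.extClass ξ' (zero_add 1) (add_comm 1 i) (show 0 + 1 + i = i + 1 by lia)
  have h2 := Abelian.Ext.comp_assoc h.shortExact.extClass (Abelian.Ext.mk₀ (ModuleCat.ofHom a))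
    ξ' (add_zero 1) (zero_add i) (show 1 + 0 + i = i + 1 by lia)
  exact (h1.symm.trans (congrArg (fun y => Abelian.Ext.comp y ξ' (add_comm 1 i)) hn.symm)).trans h2

end ModExt
end ModExtBasic

section Dimension

variable {R : Type} [CommRing R]

/-- Every chain of primes containing `I` has length less than `n`, i.e. `dim R / I < n`. -/
def IdealDimLT (I : Ideal R) (n : ℕ) : Prop :=
  ∀ l : LTSeries (PrimeSpectrum R), I ≤ l.head.asIdeal → l.length < n

/-- The annihilator of `N` has dimension less than `n`, i.e. `dim N < n`. -/
def DimLT (R : Type) [CommRing R] (N : Type) [AddCommGroup N] [Module R N] (n : ℕ) : Prop :=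
  IdealDimLT (Module.annihilator R N) n

theorem ringKrullDim_quotient_lt_iff (I : Ideal R) (n : ℕ) :
    ringKrullDim (R ⧸ I) < (n : WithBot (WithTop ℕ)) ↔ IdealDimLT I n := by
  have key : ringKrullDim (R ⧸ I) < (n : WithBot ℕ∞) ↔ IdealDimLT I n := by
    rw [ringKrullDim_quotient, Order.krullDim_lt_coe_iff]
    constructor
    · intro h l hl
      exact h ⟨l.length, fun i => ⟨l i, hl.trans (l.monotone (Fin.zero_le i))⟩, fun i => l.step i⟩
    · intro h l
      exact h ⟨l.length, fun i => (l i).1, fun i => l.step i⟩ l.head.2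
  exact key

theorem mDim_lt_iff (N : Type) [AddCommGroup N] [Module R N] (n : ℕ) :
    mDim R N < (n : WithBot (WithTop ℕ)) ↔ DimLT R N n :=
  ringKrullDim_quotient_lt_iff _ n

theorem IdealDimLT.mono_left {I J : Ideal R} (h : I ≤ J) {n : ℕ} (hI : IdealDimLT I n) :
    IdealDimLT J n :=
  fun l hl => hI l (h.trans hl)

theorem IdealDimLT.mono_right {I : Ideal R} {m n : ℕ} (h : m ≤ n) (hI : IdealDimLT I m) :
    IdealDimLT I n :=
  fun l hl => (hI l hl).trans_le h

theorem IdealDimLT.of_mul_le {I J K : Ideal R} (h : I * J ≤ K) {n : ℕ} (hI : IdealDimLT I n)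
    (hJ : IdealDimLT J n) : IdealDimLT K n := fun l hl =>
  (l.head.isPrime.mul_le.1 (h.trans hl)).elim (hI l) (hJ l)

theorem idealDimLT_zero_iff {I : Ideal R} : IdealDimLT I 0 ↔ I = ⊤ := by
  constructor
  · intro h
    by_contra hI
    obtain ⟨m, hm, hIm⟩ := Ideal.exists_le_maximal I hI
    exact absurd (h (RelSeries.singleton _ ⟨m, hm.isPrime⟩) hIm) (by simp)
  · rintro rfl l hl
    exact absurd (top_le_iff.1 hl) l.head.isPrime.ne_top

theorem IdealDimLT.of_prime_lt {p J : Ideal R} [hp : p.IsPrime] (h : p < J) {n : ℕ}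
    (H : IdealDimLT p (n + 1)) : IdealDimLT J n := by
  intro l hl
  have := H (l.cons ⟨p, hp⟩ (by exact h.trans_le hl)) (by simp)
  simpa using this

section

variable {A B C : Type} [AddCommGroup A] [Module R A] [AddCommGroup B] [Module R B]
  [AddCommGroup C] [Module R C]

theorem dimLT_zero_iff : DimLT R A 0 ↔ Subsingleton A := by
  rw [DimLT, idealDimLT_zero_iff, Module.annihilator_eq_top_iff]

theorem DimLT.mono {m n : ℕ} (hA : DimLT R A m) (h : m ≤ n) : DimLT R A n :=
  IdealDimLT.mono_right h hA

theorem DimLT.of_injective (f : A →ₗ[R] B) (hf : Function.Injective f) {n : ℕ}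
    (h : DimLT R B n) : DimLT R A n :=
  IdealDimLT.mono_left (f.annihilator_le_of_injective hf) h

theorem DimLT.of_surjective (f : A →ₗ[R] B) (hf : Function.Surjective f) {n : ℕ}
    (h : DimLT R A n) : DimLT R B n :=
  IdealDimLT.mono_left (f.annihilator_le_of_surjective hf) h

theorem DimLT.congr (e : A ≃ₗ[R] B) {n : ℕ} (h : DimLT R A n) : DimLT R B n :=
  DimLT.of_surjective e.toLinearMap e.surjective h

theorem annihilator_mul_le_of_exact (f : A →ₗ[R] B) (g : B →ₗ[R] C) (h : Function.Exact f g) :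
    Module.annihilator R A * Module.annihilator R C ≤ Module.annihilator R B := by
  rw [Ideal.mul_le]
  intro r hr s hs
  rw [Module.mem_annihilator] at *
  intro b
  have : g (s • b) = 0 := by rw [map_smul, hs]
  obtain ⟨a, ha⟩ := (h _).1 this
  rw [mul_smul, ← ha, ← map_smul, hr, map_zero]

theorem DimLT.of_exact (f : A →ₗ[R] B) (g : B →ₗ[R] C) (h : Function.Exact f g) {n : ℕ}
    (hA : DimLT R A n) (hC : DimLT R C n) : DimLT R B n :=
  IdealDimLT.of_mul_le (annihilator_mul_le_of_exact f g h) hA hC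

theorem isSES_mkQ (N : Submodule R B) : IsSES R N.subtype N.mkQ :=
  ⟨N.injective_subtype, N.mkQ_surjective, LinearMap.exact_subtype_mkQ N⟩

theorem isSES_ker (g : B →ₗ[R] C) (hg : Function.Surjective g) :
    IsSES R (LinearMap.ker g).subtype g :=
  ⟨Submodule.injective_subtype _, hg, LinearMap.exact_subtype_ker_map g⟩

theorem isSES_range (f : A →ₗ[R] B) (hf : Function.Injective f) :
    IsSES R f (LinearMap.range f).mkQ :=
  ⟨hf, Submodule.mkQ_surjective _, LinearMap.exact_map_mkQ_range f⟩

theorem IsSES.finite_left [IsNoetherianRing R] {f : A →ₗ[R] B} {g : B →ₗ[R] C}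
    (h : IsSES R f g) [Module.Finite R B] : Module.Finite R A :=
  Module.Finite.of_injective f h.1

theorem IsSES.finite_right {f : A →ₗ[R] B} {g : B →ₗ[R] C}
    (h : IsSES R f g) [Module.Finite R B] : Module.Finite R C :=
  Module.Finite.of_surjective g h.2.1

end

/-- Multiplication by `x ∉ p` on `R / p` and its cokernel. -/
theorem isSES_prime (p : Ideal R) [hp : p.IsPrime] (x : R) (hx : x ∉ p) :
    IsSES R (x • LinearMap.id : (R ⧸ p) →ₗ[R] (R ⧸ p))
      (Submodule.factor (le_sup_left : p ≤ p ⊔ Ideal.span {x})) := by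
  refine ⟨?_, Submodule.factor_surjective _, ?_⟩
  · rw [injective_iff_map_eq_zero]
    intro a
    obtain ⟨a, rfl⟩ := Ideal.Quotient.mk_surjective a
    intro h
    have h' : Ideal.Quotient.mk p (x * a) = 0 := h
    rw [Ideal.Quotient.eq_zero_iff_mem] at h' ⊢
    exact (hp.mem_or_mem h').resolve_left hx
  · intro b
    obtain ⟨b, rfl⟩ := Ideal.Quotient.mk_surjective b
    have h1 : (Submodule.factor (le_sup_left : p ≤ p ⊔ Ideal.span {x})) (Ideal.Quotient.mk p b) =
      Ideal.Quotient.mk (p ⊔ Ideal.span {x}) b := rfl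
    rw [h1, Ideal.Quotient.eq_zero_iff_mem]
    constructor
    · intro h
      obtain ⟨y, hy, z, hz, rfl⟩ := Submodule.mem_sup.1 h
      obtain ⟨c, rfl⟩ := Ideal.mem_span_singleton'.1 hz
      refine ⟨Ideal.Quotient.mk p c, ?_⟩
      change Ideal.Quotient.mk p (x * c) = _
      rw [Ideal.Quotient.eq, ← neg_mem_iff]
      convert hy using 1
      ring
    · rintro ⟨a, ha⟩
      obtain ⟨a, rfl⟩ := Ideal.Quotient.mk_surjective a
      have ha' : Ideal.Quotient.mk p (x * a) = Ideal.Quotient.mk p b := ha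
      rw [Ideal.Quotient.eq] at ha'
      have : b = -(x * a - b) + a * x := by ring
      rw [this]
      exact add_mem (Ideal.mem_sup_left (neg_mem ha'))
        (Ideal.mem_sup_right (Ideal.mem_span_singleton'.2 ⟨a, rfl⟩))

theorem prime_lt_sup_span {p : Ideal R} {x : R} (hx : x ∉ p) : p < p ⊔ Ideal.span {x} := by
  refine lt_of_le_of_ne le_sup_left fun h => hx ?_
  rw [h]
  exact Ideal.mem_sup_right (Ideal.mem_span_singleton_self x)

theorem prime_lt_annihilator {p : Ideal R} {x : R} (hx : x ∉ p) :
    p < Module.annihilator R (R ⧸ (p ⊔ Ideal.span {x})) := by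
  rw [Ideal.annihilator_quotient]
  exact prime_lt_sup_span hx

/-- Dévissage along prime filtrations, with Noetherian induction on the annihilator. -/
theorem devissage [IsNoetherianRing R]
    (P : ∀ (N : Type) [AddCommGroup N] [Module R N], Prop)
    (zero : ∀ (N : Type) [AddCommGroup N] [Module R N] [Subsingleton N], P N)
    (ext : ∀ {A B C : Type} [AddCommGroup A] [Module R A] [AddCommGroup B] [Module R B]
      [AddCommGroup C] [Module R C] [Module.Finite R A] [Module.Finite R B] [Module.Finite R C]
      {f : A →ₗ[R] B} {g : B →ₗ[R] C}, IsSES R f g → P A → P C → P B)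
    (prime : ∀ (p : Ideal R) [p.IsPrime], (∀ (N : Type) [AddCommGroup N] [Module R N]
      [Module.Finite R N], p < Module.annihilator R N → P N) → P (R ⧸ p))
    (N : Type) [AddCommGroup N] [Module R N] [Module.Finite R N] : P N := by
  have iso : ∀ {A B : Type} [AddCommGroup A] [Module R A] [AddCommGroup B] [Module R B]
      [Module.Finite R A] [Module.Finite R B] (_ : A ≃ₗ[R] B), P A → P B := by
    intro A B _ _ _ _ _ _ e hA
    refine ext (f := e.toLinearMap) (g := (0 : B →ₗ[R] PUnit)) ⟨e.injective, ?_, ?_⟩ hA (zero _)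
    · exact fun y => ⟨0, Subsingleton.elim _ _⟩
    · exact fun b => ⟨fun _ => e.surjective b, fun _ => rfl⟩
  have main : ∀ I : Ideal R, ∀ (N : Type) [AddCommGroup N] [Module R N] [Module.Finite R N],
      I ≤ Module.annihilator R N → P N := by
    intro I
    induction I using IsNoetherian.induction with
    | hgt I ih =>
      intro N _ _ hN
      refine IsNoetherianRing.induction_on_isQuotientEquivQuotientPrime R hN
        (motive := fun N _ _ _ => I ≤ Module.annihilator R N → P N) ?_ ?_ ?_
      · intro N _ _ _ _ _
        exact zero N
      · intro N _ _ _ p e hI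
        refine iso e.symm (prime p.asIdeal ?_)
        intro N' _ _ _ hlt
        refine ih _ (lt_of_le_of_lt ?_ hlt) N' le_rfl
        rw [e.annihilator_eq, Ideal.annihilator_quotient] at hI
        exact hI
      · intro N₁ _ _ _ N₂ _ _ _ N₃ _ _ _ f g hf hg hfg h₁ h₃ hI
        exact ext ⟨hf, hg, hfg⟩ (h₁ (hI.trans (f.annihilator_le_of_injective hf)))
          (h₃ (hI.trans (g.annihilator_le_of_surjective hg)))
  exact main ⊥ N bot_le

end Dimension

section Gorenstein

variable {R : Type} [CommRing R]

theorem add_natCast_le_iff (x : WithBot (WithTop ℕ)) (k i : ℕ) :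
    x + (k : WithBot (WithTop ℕ)) ≤ (i : WithBot (WithTop ℕ)) ↔
      x < ((i + 1 - k : ℕ) : WithBot (WithTop ℕ)) := by
  induction x using WithBot.recBotCoe with
  | bot => exact ⟨fun _ => WithBot.bot_lt_coe _, fun _ => by simp⟩
  | coe x =>
    induction x using WithTop.recTopCoe with
    | top =>
      refine ⟨fun h => ?_, fun h => ?_⟩
      · have h' : (⊤ : WithTop ℕ) + (k : WithTop ℕ) ≤ (i : WithTop ℕ) := WithBot.coe_le_coe.1 h
        simp at h'
      · have h' : (⊤ : WithTop ℕ) < ((i + 1 - k : ℕ) : WithTop ℕ) := WithBot.coe_lt_coe.1 h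
        simp at h'
    | coe x =>
      refine Iff.trans (b := x + k ≤ i) ?_ (Iff.trans (b := x < i + 1 - k) (by lia) ?_)
      · exact (WithBot.coe_le_coe (a := ((x : WithTop ℕ) + (k : WithTop ℕ)))
          (b := (i : WithTop ℕ))).trans (by norm_cast)
      · exact ((WithBot.coe_lt_coe (a := (x : WithTop ℕ))
          (b := ((i + 1 - k : ℕ) : WithTop ℕ))).trans (by norm_cast)).symm

theorem le_natCast_iff (x : WithBot (WithTop ℕ)) (i : ℕ) :
    x ≤ (i : WithBot (WithTop ℕ)) ↔ x < ((i + 1 : ℕ) : WithBot (WithTop ℕ)) := by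
  simpa using add_natCast_le_iff x 0 i

theorem exists_linearEquiv_modExt (A B : ModuleCat.{0} R) (n : ℕ) :
    Nonempty (RExt R A B n ≃ₗ[R] ModExt R A B n) := by
  obtain ⟨e, -⟩ := exists_natural_linearEquiv_ext B n
  exact ⟨e A⟩

variable [IsLocalRing R]

local notation "𝔪" => IsLocalRing.maximalIdeal R

/-- `R` has self-injective dimension and depth both equal to `d`, expressed through the vanishing
of `Ext`. -/
structure GorDim (R : Type) [CommRing R] [IsLocalRing R] (d : ℕ) : Prop where
  vanish : ∀ (N : Type) [AddCommGroup N] [Module R N] [Module.Finite R N] (i : ℕ), d < i →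
    ∀ ξ : ModExt R N R i, ξ = 0
  depth : ∀ i < d, ∀ ξ : ModExt R (R ⧸ IsLocalRing.maximalIdeal R) R i, ξ = 0
  nontriv : ∃ ξ : ModExt R (R ⧸ IsLocalRing.maximalIdeal R) R d, ξ ≠ 0

/-- If multiplication by `x ∈ 𝔪` is surjective up to zero on a finite module, it vanishes. -/
theorem eq_zero_of_forall_exists_smul {E : Type} [AddCommGroup E] [Module R E] [Module.Finite R E]
    {x : R} (hx : x ∈ 𝔪) (h : ∀ ξ : E, ∃ η : E, x • η = ξ) (ξ : E) : ξ = 0 := by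
  have : (⊤ : Submodule R E) = ⊥ := by
    refine Submodule.eq_bot_of_le_smul_of_le_jacobson_bot 𝔪 ⊤ Module.Finite.fg_top ?_
      (IsLocalRing.maximalIdeal_le_jacobson _)
    intro ξ _
    obtain ⟨η, rfl⟩ := h ξ
    exact Submodule.smul_mem_smul hx trivial
  exact (Submodule.mem_bot R).1 (this ▸ Submodule.mem_top)

variable [IsNoetherianRing R]

omit [IsLocalRing R] [IsNoetherianRing R] in
theorem exists_smul_eq_of_prime {Y : Type} [AddCommGroup Y] [Module R Y]
    {p : Ideal R} [p.IsPrime] {x : R} (hxp : x ∉ p) {i : ℕ} (ξ : ModExt R (R ⧸ p) Y i)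
    (h : ModExt.conn (isSES_prime p x hxp) Y i ξ = 0) : ∃ η, x • η = ξ := by
  obtain ⟨η, hη⟩ := ModExt.exists_pull_eq_of_conn (isSES_prime p x hxp) ξ h
  exact ⟨η, by rw [ModExt.smul_eq_pull, hη]⟩

theorem ext_prime_eq_zero {Y : Type} [AddCommGroup Y] [Module R Y] [Module.Finite R Y]
    {p : Ideal R} [p.IsPrime] {x : R} (hx : x ∈ 𝔪) (hxp : x ∉ p) {i : ℕ}
    (h : ∀ ξ : ModExt R (R ⧸ (p ⊔ Ideal.span {x})) Y (i + 1), ξ = 0)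
    (ξ : ModExt R (R ⧸ p) Y i) : ξ = 0 :=
  eq_zero_of_forall_exists_smul hx (fun ξ => exists_smul_eq_of_prime hxp ξ (h _)) ξ

omit [IsNoetherianRing R] in
theorem exists_mem_maximalIdeal_notMem {p : Ideal R} [hp : p.IsPrime] (h : p ≠ 𝔪) :
    ∃ x ∈ 𝔪, x ∉ p := by
  by_contra! H
  exact h (le_antisymm (IsLocalRing.le_maximalIdeal hp.ne_top) H)

omit [IsLocalRing R] [IsNoetherianRing R] in
theorem ModExt.eq_zero_of_subsingleton_left {N Y : Type} [AddCommGroup N] [Module R N]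
    [AddCommGroup Y] [Module R Y] [Subsingleton N] (i : ℕ) (ξ : ModExt R N Y i) : ξ = 0 := by
  rw [← one_smul R ξ]
  exact ModExt.smul_eq_zero_of_left 1 (fun a => Subsingleton.elim _ _) i ξ

omit [IsLocalRing R] [IsNoetherianRing R] in
theorem ModExt.eq_zero_of_ses {A B C Y : Type} [AddCommGroup A] [Module R A] [AddCommGroup B]
    [Module R B] [AddCommGroup C] [Module R C] [AddCommGroup Y] [Module R Y]
    {f : A →ₗ[R] B} {g : B →ₗ[R] C} (h : IsSES R f g) {i : ℕ}
    (hA : ∀ ξ : ModExt R A Y i, ξ = 0) (hC : ∀ ξ : ModExt R C Y i, ξ = 0)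
    (ξ : ModExt R B Y i) : ξ = 0 := by
  obtain ⟨η, rfl⟩ := ModExt.exists_pull_eq h ξ (hA _)
  rw [hC η, map_zero]

theorem ext_eq_zero_of_residue {a : ℕ}
    (h : ∀ i, a ≤ i → ∀ ξ : ModExt R (R ⧸ 𝔪) R i, ξ = 0)
    (N : Type) [AddCommGroup N] [Module R N] [Module.Finite R N] (i : ℕ) (hi : a ≤ i) :
    ∀ ξ : ModExt R N R i, ξ = 0 := by
  revert i
  refine devissage (R := R) (P := fun N _ _ => ∀ i, a ≤ i → ∀ ξ : ModExt R N R i, ξ = 0)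
    ?_ ?_ ?_ N
  · intro N _ _ _ i _ ξ
    exact ModExt.eq_zero_of_subsingleton_left i ξ
  · intro A B C _ _ _ _ _ _ _ _ _ f g hs hA hC i hi
    exact ModExt.eq_zero_of_ses hs (hA i hi) (hC i hi)
  · intro p _ H i hi
    by_cases hp : p = 𝔪
    · subst hp
      exact h i hi
    · obtain ⟨x, hx, hxp⟩ := exists_mem_maximalIdeal_notMem hp
      exact ext_prime_eq_zero hx hxp (H _ (prime_lt_annihilator hxp) _ (by lia))

omit [IsLocalRing R] [IsNoetherianRing R] in
theorem isSES_smul {N : Type} [AddCommGroup N] [Module R N] {r : R} (hr : IsSMulRegular N r) :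
    IsSES R (r • LinearMap.id : N →ₗ[R] N)
      (LinearMap.range (r • LinearMap.id : N →ₗ[R] N)).mkQ :=
  isSES_range _ fun _ _ h => hr h

theorem le_of_depth {d : ℕ}
    (hv : ∀ (N : Type) [AddCommGroup N] [Module R N] [Module.Finite R N] (i : ℕ), d < i →
      ∀ ξ : ModExt R N R i, ξ = 0)
    (hd : ∃ ξ : ModExt R (R ⧸ 𝔪) R d, ξ ≠ 0) (s : ℕ) :
    ∀ (t : ℕ) (N : Type) [AddCommGroup N] [Module R N] [Module.Finite R N],
      (∀ l < s, ∀ ξ : ModExt R (R ⧸ 𝔪) N l, ξ = 0) →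
      (∃ ξ : ModExt R (R ⧸ 𝔪) N s, ξ ≠ 0) →
      (∀ j, t < j → ∀ ξ : ModExt R N R j, ξ = 0) → d ≤ t + s := by
  induction s with
  | zero =>
    intro t N _ _ _ _ ⟨ξ, hξ⟩ hN
    by_contra! hlt
    have hs : IsSimpleModule R (R ⧸ 𝔪) := isSimpleModule_iff_quot_maximal.2
      ⟨𝔪, inferInstance, ⟨LinearEquiv.refl _ _⟩⟩
    have hne : ModExt.zeroEquiv R (R ⧸ 𝔪) N ξ ≠ 0 := fun h => hξ (by simpa using h)
    have hinj := (LinearMap.injective_or_eq_zero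
      (ModExt.zeroEquiv R (R ⧸ 𝔪) N ξ)).resolve_right hne
    obtain ⟨η, hη⟩ := hd
    obtain ⟨ζ, hζ⟩ := ModExt.exists_pull_eq_of_conn (isSES_range _ hinj) η
      (hv _ _ (Nat.lt_succ_self d) _)
    refine hη ?_
    rw [← hζ, hN d (by lia) ζ, map_zero]
  | succ s ih =>
    intro t N _ _ _ hl ⟨ξ, hξ⟩ hN
    have h0 : Subsingleton ((R ⧸ 𝔪) →ₗ[R] N) := by
      refine ⟨fun f g => ?_⟩
      apply (ModExt.zeroEquiv R (R ⧸ 𝔪) N).symm.injective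
      exact (hl 0 (by lia) _).trans (hl 0 (by lia) _).symm
    obtain ⟨r, hr, hreg⟩ := IsSMulRegular.subsingleton_linearMap_iff.1 h0
    have hses := isSES_smul hreg
    have hrk : ∀ (l : ℕ) (ζ : ModExt R (R ⧸ 𝔪) N l),
        ModExt.push _ (r • LinearMap.id : N →ₗ[R] N) l ζ = 0 := by
      intro l ζ
      rw [← ModExt.smul_eq_push]
      exact ModExt.smul_eq_zero_of_left r (Module.mem_annihilator.1 hr) l ζ
    have := ih (t + 1) (N ⧸ LinearMap.range (r • LinearMap.id : N →ₗ[R] N)) ?_ ?_ ?_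
    · lia
    · intro l hlt ζ
      obtain ⟨η, rfl⟩ := ModExt.exists_push_eq_of_coconn hses ζ (hl _ (by lia) _)
      rw [hl _ (by lia) η, map_zero]
    · obtain ⟨η, rfl⟩ := ModExt.exists_coconn_eq hses ξ (hrk _ _)
      exact ⟨η, fun h => hξ (by rw [h, map_zero])⟩
    · intro j hj ζ
      obtain ⟨j, rfl⟩ : ∃ j', j = j' + 1 := ⟨j - 1, by lia⟩
      obtain ⟨η, rfl⟩ := ModExt.exists_conn_eq hses ζ (hN _ (by lia) _)
      rw [hN _ (by lia) η, map_zero]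

theorem exists_gorDim (h : IsGorensteinRing R) : ∃ d, GorDim R d := by
  classical
  obtain ⟨-, -, n, hn⟩ := h
  have hex : ∃ a, ∀ i, a ≤ i → ∀ ξ : ModExt R (R ⧸ 𝔪) R i, ξ = 0 := by
    refine ⟨n + 1, fun i hi ξ => ?_⟩
    obtain ⟨e⟩ := exists_linearEquiv_modExt (ModuleCat.of R (R ⧸ 𝔪)) (ModuleCat.of R R) i
    have := hn (ModuleCat.of R (R ⧸ 𝔪)) i hi
    exact e.symm.injective (Subsingleton.elim _ _)
  have hspec := ext_eq_zero_of_residue (Nat.find_spec hex)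
  have hpos : Nat.find hex ≠ 0 := by
    intro h0
    have := hspec R 0 (by lia) ((ModExt.zeroEquiv R R R).symm LinearMap.id)
    rw [LinearEquiv.map_eq_zero_iff] at this
    exact one_ne_zero (LinearMap.congr_fun this (1 : R))
  obtain ⟨d, hd⟩ := Nat.exists_eq_succ_of_ne_zero hpos
  have hv : ∀ (N : Type) [AddCommGroup N] [Module R N] [Module.Finite R N] (i : ℕ), d < i →
      ∀ ξ : ModExt R N R i, ξ = 0 := fun N _ _ _ i hi => hspec N i (by lia)
  have hnt : ∃ ξ : ModExt R (R ⧸ 𝔪) R d, ξ ≠ 0 := by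
    by_contra! H
    refine Nat.find_min hex (m := d) (by lia) fun i hi ξ => ?_
    obtain rfl | hlt := hi.eq_or_lt
    · exact H ξ
    · exact hv _ i hlt ξ
  have hex' : ∃ s, ∃ ξ : ModExt R (R ⧸ 𝔪) R s, ξ ≠ 0 := ⟨d, hnt⟩
  have hle := le_of_depth hv hnt (Nat.find hex') 0 R
    (fun l hl ξ => by_contra fun hξ => Nat.find_min hex' hl ⟨ξ, hξ⟩) (Nat.find_spec hex')
    (fun j hj ξ => by
      obtain ⟨j, rfl⟩ : ∃ j', j = j' + 1 := ⟨j - 1, by lia⟩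
      exact ModExt.eq_zero_of_free j ξ)
  exact ⟨d, hv, fun i hi ξ => by_contra fun hξ => Nat.find_min hex' (m := i) (by lia) ⟨ξ, hξ⟩, hnt⟩

namespace GorDim

variable {d : ℕ} (hG : GorDim R d)
include hG

theorem ext_eq_zero (N : Type) [AddCommGroup N] [Module R N] [Module.Finite R N] (n i : ℕ)
    (hN : DimLT R N n) (hi : i + n ≤ d) : ∀ ξ : ModExt R N R i, ξ = 0 := by
  revert n i
  refine devissage (R := R) (P := fun N _ _ => ∀ n i, DimLT R N n → i + n ≤ d →
    ∀ ξ : ModExt R N R i, ξ = 0) ?_ ?_ ?_ N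
  · intro N _ _ _ n i _ _ ξ
    exact ModExt.eq_zero_of_subsingleton_left i ξ
  · intro A B C _ _ _ _ _ _ _ _ _ f g hs hA hC n i hB hi
    exact ModExt.eq_zero_of_ses hs (hA n i (hB.of_injective f hs.1) hi)
      (hC n i (hB.of_surjective g hs.2.1) hi)
  · intro p _ H n i hn hi
    cases n with
    | zero =>
      have := dimLT_zero_iff.1 hn
      exact ModExt.eq_zero_of_subsingleton_left i
    | succ n =>
      by_cases hp : p = 𝔪
      · subst hp
        exact hG.depth i (by lia)
      · obtain ⟨x, hx, hxp⟩ := exists_mem_maximalIdeal_notMem hp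
        refine ext_prime_eq_zero hx hxp (H _ (prime_lt_annihilator hxp) n _ ?_ (by lia))
        rw [DimLT, Ideal.annihilator_quotient] at hn
        exact hn.of_prime_lt (prime_lt_annihilator hxp)

end GorDim

omit [IsLocalRing R] in
theorem annihilator_ext_le {Y : Type} [AddCommGroup Y] [Module R Y] [Module.Finite R Y]
    {p P : Ideal R} [p.IsPrime] [hP : P.IsPrime] {x : R} (hxp : x ∉ p) (hxP : x ∈ P) {j : ℕ}
    (h : Module.annihilator R (ModExt R (R ⧸ p) Y j) ≤ P) :
    Module.annihilator R (ModExt R (R ⧸ (p ⊔ Ideal.span {x})) Y (j + 1)) ≤ P := by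
  intro y hy
  by_contra hyP
  set E := ModExt R (R ⧸ p) Y j
  have hrange : LinearMap.range (algebraMap R (Module.End R E) y) ≤
      Ideal.span {x} • (⊤ : Submodule R E) := by
    rintro _ ⟨ξ, rfl⟩
    rw [Module.algebraMap_end_apply]
    obtain ⟨η, hη⟩ := ModExt.exists_pull_eq_of_conn (isSES_prime p x hxp) (y • ξ) (by
      rw [map_smul, Module.mem_annihilator.1 hy])
    rw [← hη, ← ModExt.smul_eq_pull]
    exact Submodule.smul_mem_smul (Ideal.mem_span_singleton_self x) trivial
  obtain ⟨f, hmon, -, hcoeff, hf⟩ :=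
    LinearMap.exists_monic_and_natDegree_eq_and_coeff_mem_pow_and_aeval_eq_zero R _ _ hrange
  rw [Polynomial.aeval_algebraMap_apply, Polynomial.coe_aeval_eq_eval] at hf
  have h1 : f.eval y ∈ P := h (Module.mem_annihilator.2 fun ξ => by
    simpa using LinearMap.congr_fun hf ξ)
  rw [Polynomial.eval_eq_sum_range, Finset.sum_range_succ, hmon.coeff_natDegree, one_mul] at h1
  have h2 : ∑ k ∈ Finset.range f.natDegree, f.coeff k * y ^ k ∈ P := by
    refine sum_mem fun k hk => P.mul_mem_right _ ?_
    have := Ideal.pow_le_self (Nat.sub_ne_zero_of_lt (Finset.mem_range.1 hk)) (hcoeff k)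
    exact (Ideal.span_singleton_le_iff_mem P).2 hxP this
  exact hyP (hP.mem_of_pow_mem _ ((P.add_mem_iff_right h2).1 h1))

namespace GorDim

variable {d : ℕ} (hG : GorDim R d)
include hG

theorem dimLT_ext (N : Type) [AddCommGroup N] [Module R N] [Module.Finite R N] (j : ℕ) :
    DimLT R (ModExt R N R j) (d + 1 - j) := by
  revert j
  refine devissage (R := R) (P := fun N _ _ => ∀ j, DimLT R (ModExt R N R j) (d + 1 - j)) ?_ ?_ ?_ N
  · intro N _ _ _ j
    have : Subsingleton (ModExt R N R j) :=
      subsingleton_of_forall_eq 0 (ModExt.eq_zero_of_subsingleton_left j)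
    exact (dimLT_zero_iff.2 this).mono (Nat.zero_le _)
  · intro A B C _ _ _ _ _ _ _ _ _ f g hs hA hC j
    exact (hC j).of_exact (ModExt.pull g R j) (ModExt.pull f R j) (fun ξ =>
      ⟨fun h => ModExt.exists_pull_eq hs ξ h, fun ⟨η, hη⟩ =>
        hη ▸ ModExt.pull_pull_eq_zero hs η⟩) (hA j)
  · intro p _ H j
    by_cases hj : d < j
    · have : Subsingleton (ModExt R (R ⧸ p) R j) :=
        subsingleton_of_forall_eq 0 (hG.vanish _ j hj)
      exact (dimLT_zero_iff.2 this).mono (Nat.zero_le _)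
    · intro l hl
      by_cases h0 : l.length = 0
      · lia
      · have hlt : l.head < (l.tail h0).head := by
          rw [RelSeries.head_tail]
          exact l.strictMono (by
            rw [Fin.lt_def]
            simp [Nat.mod_eq_of_lt (show 1 < l.length + 1 by lia)])
        have hple : p ≤ l.head.asIdeal := by
          refine le_trans (fun x hx => ?_) hl
          refine Module.mem_annihilator.2 fun ξ => ModExt.smul_eq_zero_of_left x (fun a => ?_) j ξ
          have : x ∈ Module.annihilator R (R ⧸ p) := by rwa [Ideal.annihilator_quotient]
          exact Module.mem_annihilator.1 this a
        obtain ⟨x, hx1, hx0⟩ := Set.exists_of_ssubset (show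
          (l.head.asIdeal : Set R) ⊂ ((l.tail h0).head.asIdeal : Set R) from hlt)
        have hxp : x ∉ p := fun h => hx0 (hple h)
        have := H _ (prime_lt_annihilator hxp) (j + 1) (l.tail h0)
          (annihilator_ext_le hxp hx1 (hl.trans hlt.le))
        rw [RelSeries.tail_length] at this
        lia

theorem ringKrullDim_eq : ringKrullDim R = (d : WithBot (WithTop ℕ)) := by
  have hann : Module.annihilator R R = ⊥ := by
    rw [Module.annihilator_eq_bot]; infer_instance
  have hm : mDim R R = ringKrullDim R := by
    rw [mDim, hann]
    exact ringKrullDim_eq_of_ringEquiv (RingEquiv.quotientBot R)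
  have h1 : DimLT R R (d + 1) :=
    ((hG.dimLT_ext R 0).congr (ModExt.zeroEquiv R R R)).congr (LinearMap.ringLmapEquivSelf R R R)
  have h2 : ¬ DimLT R R d := fun h => by
    have := hG.ext_eq_zero R d 0 h (by lia) ((ModExt.zeroEquiv R R R).symm LinearMap.id)
    rw [LinearEquiv.map_eq_zero_iff] at this
    exact one_ne_zero (LinearMap.congr_fun this (1 : R))
  rw [← mDim_lt_iff, hm] at h1 h2
  refine le_antisymm ?_ (not_lt.1 h2)
  exact (le_natCast_iff _ d).2 h1

end GorDim

end Gorenstein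

section Duality

variable {R : Type} [CommRing R] {A B C : Type} [AddCommGroup A] [Module R A] [AddCommGroup B]
  [Module R B] [AddCommGroup C] [Module R C] {f : A →ₗ[R] B} {g : B →ₗ[R] C}

open Module (Dual)

/-- The image of the dual of the first map of a short exact sequence. -/
abbrev dualRange (f : A →ₗ[R] B) : Submodule R (Dual R A) := LinearMap.range f.dualMap

theorem IsSES.dual (h : IsSES R f g) :
    IsSES R (A := Dual R C) (B := Dual R B) (C := dualRange f) g.dualMap
      f.dualMap.rangeRestrict := by
  refine ⟨LinearMap.dualMap_injective_of_surjective h.2.1, LinearMap.surjective_rangeRestrict _,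
    fun φ => ⟨fun hφ => ?_, ?_⟩⟩
  · have hφ' : φ ∘ₗ f = 0 := congrArg Subtype.val hφ
    obtain ⟨η, hη⟩ := ModExt.exists_pull_eq h ((ModExt.zeroEquiv R B R).symm φ) (by
      rw [ModExt.pull_zeroEquiv_symm, hφ', map_zero])
    refine ⟨ModExt.zeroEquiv R C R η, ?_⟩
    have := ModExt.zeroEquiv_pull g η
    rw [hη, LinearEquiv.apply_symm_apply] at this
    exact this.symm
  · rintro ⟨ψ, rfl⟩
    apply Subtype.ext
    change (ψ ∘ₗ g) ∘ₗ f = 0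
    rw [LinearMap.comp_assoc, h.2.2.linearMap_comp_eq_zero, LinearMap.comp_zero]

/-- The connecting map from the dual of the first term. -/
noncomputable def IsSES.dualConn (h : IsSES R f g) : Dual R A →ₗ[R] ModExt R C R 1 :=
  ModExt.conn h R 0 ∘ₗ (ModExt.zeroEquiv R A R).symm.toLinearMap

theorem IsSES.dualConn_eq_zero_iff (h : IsSES R f g) (φ : Dual R A) :
    h.dualConn φ = 0 ↔ φ ∈ dualRange f := by
  constructor
  · intro hφ
    obtain ⟨η, hη⟩ := ModExt.exists_pull_eq_of_conn h _ hφ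
    refine ⟨ModExt.zeroEquiv R B R η, ?_⟩
    have := ModExt.zeroEquiv_pull f η
    rw [hη] at this
    exact this.symm.trans (LinearEquiv.apply_symm_apply _ _)
  · rintro ⟨ψ, rfl⟩
    have := ModExt.conn_pull h ((ModExt.zeroEquiv R B R).symm ψ)
    rwa [ModExt.pull_zeroEquiv_symm] at this

theorem IsSES.dual_range (h : IsSES R f g) [Module.Free R B] :
    IsSES R (A := dualRange f) (B := Dual R A) (dualRange f).subtype h.dualConn := by
  refine ⟨Submodule.injective_subtype _, fun ξ => ?_, fun φ => ?_⟩
  · obtain ⟨η, hη⟩ := ModExt.exists_conn_eq h ξ (ModExt.eq_zero_of_free _ _)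
    exact ⟨ModExt.zeroEquiv R A R η, by simpa [IsSES.dualConn] using hη⟩
  · rw [h.dualConn_eq_zero_iff]
    simp

theorem exists_comp_eq_of_ext_one {Y : Type} [AddCommGroup Y] [Module R Y] (h : IsSES R f g)
    (hC : ∀ ξ : ModExt R C Y 1, ξ = 0) (u : A →ₗ[R] Y) : ∃ v : B →ₗ[R] Y, v ∘ₗ f = u := by
  obtain ⟨η, hη⟩ := ModExt.exists_pull_eq_of_conn h ((ModExt.zeroEquiv R A Y).symm u) (hC _)
  refine ⟨ModExt.zeroEquiv R B Y η, ?_⟩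
  rw [← ModExt.zeroEquiv_pull, hη, LinearEquiv.apply_symm_apply]

theorem exists_comp_eq_of_surjective {Y : Type} [AddCommGroup Y] [Module R Y] (h : IsSES R f g)
    (u : B →ₗ[R] Y) (hu : u ∘ₗ f = 0) : ∃ v : C →ₗ[R] Y, v ∘ₗ g = u := by
  obtain ⟨η, hη⟩ := ModExt.exists_pull_eq h ((ModExt.zeroEquiv R B Y).symm u) (by
    rw [ModExt.pull_zeroEquiv_symm, hu, map_zero])
  refine ⟨ModExt.zeroEquiv R C Y η, ?_⟩
  rw [← ModExt.zeroEquiv_pull, hη, LinearEquiv.apply_symm_apply]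

theorem ModExt.conn_injective_of_free {Y : Type} [AddCommGroup Y] [Module R Y] [Module.Free R B]
    (h : IsSES R f g) (j : ℕ) : Function.Injective (ModExt.conn h Y (j + 1)) := by
  rw [injective_iff_map_eq_zero]
  intro ξ hξ
  obtain ⟨η, rfl⟩ := ModExt.exists_pull_eq_of_conn h ξ hξ
  rw [ModExt.eq_zero_of_free j η, map_zero]

theorem ModExt.conn_surjective_of_free {Y : Type} [AddCommGroup Y] [Module R Y] [Module.Free R B]
    (h : IsSES R f g) (j : ℕ) : Function.Surjective (ModExt.conn h Y j) :=
  fun ξ => ModExt.exists_conn_eq h ξ (ModExt.eq_zero_of_free j _)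

theorem exists_free_cover [IsNoetherianRing R] (N : Type) [AddCommGroup N] [Module R N]
    [Module.Finite R N] : ∃ (n : ℕ) (g : (Fin n → R) →ₗ[R] N),
      IsSES R (LinearMap.ker g).subtype g := by
  obtain ⟨n, g, hg⟩ := Module.Finite.exists_fin' R N
  exact ⟨n, g, isSES_ker g hg⟩

instance finite_dual_of_noetherian [IsNoetherianRing R] [Module.Finite R A] :
    Module.Finite R (Dual R A) :=
  Module.Finite.equiv (ModExt.zeroEquiv R A R)

theorem exists_eval_eq_of_free [Module.Free R B] [Module.Finite R B] (w : Dual R (Dual R B)) :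
    ∃ b : B, Module.Dual.eval R B b = w :=
  (Module.bijective_dual_eval R B).2 w

theorem eq_of_forall_dual_of_free [Module.Free R B] [Module.Finite R B] {b b' : B}
    (h : ∀ φ : Dual R B, φ b = φ b') : b = b' :=
  (Module.bijective_dual_eval R B).1 (LinearMap.ext h)

theorem exists_eval_eq_of_ext_one [Module.Free R B] [Module.Finite R B] (h : IsSES R f g)
    (hI : ∀ ξ : ModExt R (dualRange f) R 1, ξ = 0) (v : Dual R (Dual R C)) :
    ∃ c : C, Module.Dual.eval R C c = v := by
  obtain ⟨w, hw⟩ := exists_comp_eq_of_ext_one h.dual hI v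
  obtain ⟨b, rfl⟩ := exists_eval_eq_of_free w
  exact ⟨g b, by rw [← hw]; rfl⟩

end Duality

section Syzygies

open Module (Dual)

variable {R : Type} [CommRing R]

theorem IsKSyzygy.congr {k : ℕ} {M N : ModuleCat.{0} R} (e : M ≃ₗ[R] N) (h : IsKSyzygy R M k) :
    IsKSyzygy R N k := by
  cases k with
  | zero => trivial
  | succ k =>
    obtain ⟨F, hF, hF', f, hf, hs⟩ := h
    refine ⟨F, hF, hF', f ∘ₗ e.symm.toLinearMap, hf.comp e.symm.injective, ?_⟩
    have : LinearMap.range (f ∘ₗ e.symm.toLinearMap) = LinearMap.range f :=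
      LinearMap.range_comp_of_range_eq_top _ e.symm.range
    rwa [this]

variable {A B C : Type} [AddCommGroup A] [Module R A] [AddCommGroup B]
  [Module R B] [AddCommGroup C] [Module R C] {f : A →ₗ[R] B} {g : B →ₗ[R] C}

theorem IsKSyzygy.succ_of_ses [Module.Free R B] [Module.Finite R B] (h : IsSES R f g) {k : ℕ}
    (hC : IsKSyzygy R (ModuleCat.of R C) k) : IsKSyzygy R (ModuleCat.of R A) (k + 1) := by
  refine ⟨ModuleCat.of R B, ‹_›, ‹_›, f, h.1, hC.congr ?_⟩
  exact (((Submodule.quotEquivOfEq _ _ (h.2.2.linearMap_ker_eq.symm)).trans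
    (g.quotKerEquivOfSurjective h.2.1)).symm : C ≃ₗ[R] (B ⧸ LinearMap.range f))

theorem isKSyzygy_one_of_injective [Module.Free R B] [Module.Finite R B]
    (hf : Function.Injective f) : IsKSyzygy R (ModuleCat.of R A) 1 :=
  ⟨ModuleCat.of R B, ‹_›, ‹_›, f, hf, trivial⟩

theorem IsKSyzygy.mono {k l : ℕ} (hkl : k ≤ l) :
    ∀ {M : ModuleCat.{0} R}, IsKSyzygy R M l → IsKSyzygy R M k := by
  induction k generalizing l with
  | zero => intro _ _; trivial
  | succ k ih =>
    intro M h
    obtain ⟨l, rfl⟩ : ∃ l', l = l' + 1 := ⟨l - 1, by lia⟩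
    obtain ⟨F, hF, hF', f, hf, hs⟩ := h
    exact ⟨F, hF, hF', f, hf, ih (by lia) hs⟩

/-- The dimension condition on `Ext^j(M, R)`, `j ≥ 1`, that characterizes `k`-syzygies over a
Gorenstein ring of dimension `d`. -/
def SyzDim (R : Type) [CommRing R] (d k : ℕ) (M : Type) [AddCommGroup M] [Module R M] : Prop :=
  ∀ j, 1 ≤ j → DimLT R (ModExt R M R j) (d + 1 - j - k)

theorem SyzDim.mono {d k l : ℕ} (hkl : k ≤ l) (h : SyzDim R d l A) : SyzDim R d k A :=
  fun j hj => (h j hj).mono (by lia)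

theorem SyzDim.succ_of_ses [Module.Free R B] (h : IsSES R f g) {d k : ℕ} (hC : SyzDim R d k C) :
    SyzDim R d (k + 1) A := by
  intro j hj
  obtain ⟨j, rfl⟩ : ∃ j', j = j' + 1 := ⟨j - 1, by lia⟩
  exact ((hC (j + 1 + 1) (by lia)).of_injective _ (ModExt.conn_injective_of_free h j)).mono (by lia)

variable [IsLocalRing R] [IsNoetherianRing R] {d : ℕ} (hG : GorDim R d)
include hG

namespace GorDim

theorem ext_ext_eq_zero [Module.Finite R A] {k j i : ℕ} (h : SyzDim R d k A) (hj : 1 ≤ j)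
    (hi : i + 1 ≤ j + k) (ξ : ModExt R (ModExt R A R j) R i) : ξ = 0 := by
  by_cases hjk : j + k ≤ d + 1
  · exact hG.ext_eq_zero _ _ i (h j hj) (by lia) ξ
  · have := h j hj
    rw [show d + 1 - j - k = 0 by lia, dimLT_zero_iff] at this
    exact ModExt.eq_zero_of_subsingleton_left i ξ

theorem syzDim_of_isKSyzygy (k : ℕ) : ∀ (M : ModuleCat.{0} R) [Module.Finite R M],
    IsKSyzygy R M k → SyzDim R d k M := by
  induction k with
  | zero => exact fun M _ _ j _ => hG.dimLT_ext M j
  | succ k ih =>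
    rintro M _ ⟨F, hF, hF', f, hf, hs⟩
    have := ih (ModuleCat.of R (F ⧸ LinearMap.range f)) hs
    exact SyzDim.succ_of_ses (isSES_range f hf) this

theorem ext_dualRange_eq_zero_of_lt (b : ℕ) : ∀ {A B C : Type} [AddCommGroup A] [Module R A]
    [AddCommGroup B] [Module R B] [AddCommGroup C] [Module R C] [Module.Finite R B]
    [Module.Free R B] {f : A →ₗ[R] B} {g : B →ₗ[R] C} (_ : IsSES R f g) {a : ℕ} (_ : d < a + b)
    (_ : 1 ≤ a) (_ : SyzDim R d (a + 1) C) (ξ : ModExt R (dualRange f) R a), ξ = 0 := by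
  induction b with
  | zero =>
    intro A B C _ _ _ _ _ _ _ _ f g h a hd _ _ ξ
    have := h.finite_left
    exact hG.vanish _ a hd ξ
  | succ b ih =>
    intro A B C _ _ _ _ _ _ _ _ f g h a hd ha hC ξ
    have := h.finite_left
    have := h.finite_right
    obtain ⟨η, rfl⟩ := ModExt.exists_pull_eq_of_conn h.dual_range ξ
      (hG.ext_ext_eq_zero hC le_rfl (by lia) _)
    obtain ⟨n, π, hπ⟩ := exists_free_cover (R := R) A
    obtain ⟨a, rfl⟩ : ∃ a', a = a' + 1 := ⟨a - 1, by lia⟩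
    rw [ModExt.conn_injective_of_free hπ.dual a
      ((ih hπ (by lia) (by lia) (hC.succ_of_ses h) (ModExt.conn hπ.dual R _ η)).trans
        (map_zero _).symm), map_zero]

theorem ext_dualRange_eq_zero [Module.Finite R B] [Module.Free R B] (h : IsSES R f g)
    {a : ℕ} (ha : 1 ≤ a) (hC : SyzDim R d (a + 1) C) (ξ : ModExt R (dualRange f) R a) : ξ = 0 :=
  hG.ext_dualRange_eq_zero_of_lt (d + 1) h (by lia) ha hC ξ

theorem torsionless_of_syzDim [Module.Finite R A] (hA : SyzDim R d 1 A) (m : A)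
    (hm : ∀ φ : Dual R A, φ m = 0) : m = 0 := by
  obtain ⟨n, g, h⟩ := exists_free_cover (R := R) A
  have := h.finite_left
  obtain ⟨p, rfl⟩ := h.2.1 m
  obtain ⟨u, hu⟩ := exists_comp_eq_of_surjective h.dual (Module.Dual.eval R _ p)
    (LinearMap.ext hm)
  obtain ⟨v, hv⟩ := exists_comp_eq_of_ext_one h.dual_range
    (hG.ext_ext_eq_zero hA le_rfl (by lia)) u
  obtain ⟨n', g', h'⟩ := exists_free_cover (R := R) (LinearMap.ker g)
  obtain ⟨c, rfl⟩ := exists_eval_eq_of_ext_one h'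
    (hG.ext_dualRange_eq_zero h' le_rfl (hA.succ_of_ses h)) v
  have : p = c := eq_of_forall_dual_of_free fun φ => by
    have h1 := LinearMap.congr_fun hu φ
    rw [← hv] at h1
    exact h1.symm
  rw [this]
  exact c.2

theorem isKSyzygy_of_syzDim (k : ℕ) : ∀ (M : ModuleCat.{0} R) [Module.Finite R M],
    SyzDim R d k M → IsKSyzygy R M k := by
  induction k with
  | zero => intros; trivial
  | succ k ih =>
    intro M _ hM
    obtain ⟨n, π, hπ⟩ := exists_free_cover (R := R) (Dual R M)
    let f : M →ₗ[R] Dual R (Fin n → R) := π.dualMap ∘ₗ Module.Dual.eval R M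
    have hf : Function.Injective f := by
      rw [injective_iff_map_eq_zero]
      intro m hm
      refine hG.torsionless_of_syzDim (hM.mono (by lia)) m fun φ => ?_
      obtain ⟨x, rfl⟩ := hπ.2.1 φ
      exact LinearMap.congr_fun hm x
    have h := isSES_range f hf
    refine IsKSyzygy.succ_of_ses h (ih (ModuleCat.of R _) fun j hj => ?_)
    obtain ⟨j, rfl⟩ : ∃ j', j = j' + 1 := ⟨j - 1, by lia⟩
    cases j with
    | zero =>
      refine (dimLT_zero_iff.2 (subsingleton_of_forall_eq 0 fun ξ => ?_)).mono (Nat.zero_le _)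
      obtain ⟨φ, rfl⟩ := h.dual_range.2.1 ξ
      rw [h.dualConn_eq_zero_iff]
      obtain ⟨x, rfl⟩ := hπ.2.1 φ
      exact ⟨Module.Dual.eval R _ x, rfl⟩
    | succ j =>
      exact ((hM (j + 1) (by lia)).of_surjective _ (ModExt.conn_surjective_of_free h _)).mono
        (by lia)

theorem isKSyzygy_iff_syzDim (k : ℕ) (M : ModuleCat.{0} R) [Module.Finite R M] :
    IsKSyzygy R M k ↔ SyzDim R d k M :=
  ⟨hG.syzDim_of_isKSyzygy k M, hG.isKSyzygy_of_syzDim k M⟩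

theorem reflexive_of_isKSyzygy {k : ℕ} (M : ModuleCat.{0} R) [Module.Finite R M]
    (h : IsKSyzygy R M (k + 2)) : Module.IsReflexive R M := by
  have hM1 := hG.syzDim_of_isKSyzygy 1 M (h.mono (by lia))
  obtain ⟨F, hF, hF', f, hf, hs⟩ := h
  have hses := isSES_range f hf
  have hS := hG.syzDim_of_isKSyzygy _ (ModuleCat.of R (F ⧸ LinearMap.range f)) hs
  refine ⟨⟨fun m m' hmm => sub_eq_zero.1 (hG.torsionless_of_syzDim hM1 _ fun φ => ?_),
    fun v => ?_⟩⟩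
  · rw [map_sub, sub_eq_zero]
    exact LinearMap.congr_fun hmm φ
  · obtain ⟨b, hb⟩ := exists_eval_eq_of_free (B := F) (v ∘ₗ f.dualMap)
    have hb0 : (LinearMap.range f).mkQ b = 0 := by
      refine hG.torsionless_of_syzDim (hS.mono (by lia)) _ fun φ => ?_
      have h1 := LinearMap.congr_fun hb ((LinearMap.range f).mkQ.dualMap φ)
      refine h1.trans ?_
      have h2 : f.dualMap ((LinearMap.range f).mkQ.dualMap φ) = 0 := by
        ext m
        exact (congrArg φ (hses.2.2.apply_apply_eq_zero m)).trans (map_zero φ)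
      rw [LinearMap.comp_apply, h2, map_zero]
    obtain ⟨m, rfl⟩ := (hses.2.2 b).1 hb0
    refine ⟨m, ?_⟩
    obtain ⟨w, hw⟩ := exists_comp_eq_of_surjective hses.dual_range (Module.Dual.eval R M m - v) (by
      ext ⟨_, φ, rfl⟩
      exact sub_eq_zero.2 (LinearMap.congr_fun hb φ))
    have hw0 : w = 0 := by
      have := hG.ext_ext_eq_zero hS le_rfl (by lia) ((ModExt.zeroEquiv R _ R).symm w)
      rwa [LinearEquiv.map_eq_zero_iff] at this
    rw [← sub_eq_zero, ← hw, hw0, LinearMap.zero_comp]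

theorem ext_dual_eq_zero_of_isKSyzygy (k : ℕ) : ∀ (M : ModuleCat.{0} R) [Module.Finite R M]
    (_ : IsKSyzygy R M k) (i : ℕ) (_ : 1 ≤ i) (_ : i + 2 ≤ k) (ξ : ModExt R (Dual R M) R i),
    ξ = 0 := by
  induction k with
  | zero => lia
  | succ k ih =>
    intro M _ hM i hi hik ξ
    obtain ⟨F, hF, hF', f, hf, hs⟩ := hM
    have h := isSES_range f hf
    have hS := hG.syzDim_of_isKSyzygy _ (ModuleCat.of R (F ⧸ LinearMap.range f)) hs
    have hr : Module.IsReflexive R (F ⧸ LinearMap.range f) := by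
      obtain ⟨k, rfl⟩ : ∃ k', k = k' + 2 := ⟨k - 2, by lia⟩
      exact hG.reflexive_of_isKSyzygy (ModuleCat.of R (F ⧸ LinearMap.range f)) hs
    refine ModExt.eq_zero_of_ses h.dual_range (fun ξ => ?_)
      (hG.ext_ext_eq_zero hS le_rfl (by lia)) ξ
    obtain ⟨i, rfl⟩ : ∃ i', i = i' + 1 := ⟨i - 1, by lia⟩
    obtain ⟨η, rfl⟩ := ModExt.conn_surjective_of_free h.dual _ ξ
    cases i with
    | zero =>
      obtain ⟨v, rfl⟩ := (ModExt.zeroEquiv R _ R).symm.surjective η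
      obtain ⟨c, rfl⟩ := (Module.bijective_dual_eval R (F ⧸ LinearMap.range f)).2 v
      obtain ⟨b, rfl⟩ := h.2.1 c
      have : Module.Dual.eval R _ ((LinearMap.range f).mkQ b) =
        Module.Dual.eval R F b ∘ₗ (LinearMap.range f).mkQ.dualMap := rfl
      rw [this, ← ModExt.pull_zeroEquiv_symm, ModExt.conn_pull]
    | succ i =>
      rw [ih (ModuleCat.of R (F ⧸ LinearMap.range f)) hs (i + 1) (by lia) (by lia) η, map_zero]

end GorDim

omit hG [IsLocalRing R] in
theorem isKSyzygy_dual (k : ℕ) : ∀ (X : Type) [AddCommGroup X] [Module R X] [Module.Finite R X]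
    (_ : ∀ i, 1 ≤ i → i + 2 ≤ k → ∀ ξ : ModExt R X R i, ξ = 0),
    IsKSyzygy R (ModuleCat.of R (Dual R X)) k := by
  induction k with
  | zero => intros; trivial
  | succ k ih =>
    intro X _ _ _ hX
    obtain ⟨n, π, h⟩ := exists_free_cover (R := R) X
    have := h.finite_left
    refine IsKSyzygy.succ_of_ses h.dual ?_
    match k, ih, hX with
    | 0, _, _ => trivial
    | 1, _, _ =>
      obtain ⟨n', π', h'⟩ := exists_free_cover (R := R) (LinearMap.ker π)
      exact isKSyzygy_one_of_injective (f := π'.dualMap ∘ₗ (dualRange _).subtype)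
        (h'.dual.1.comp (Submodule.injective_subtype _))
    | k + 2, ih, hX =>
      have htop : dualRange (LinearMap.ker π).subtype = ⊤ := by
        rw [eq_top_iff]
        intro φ _
        rw [← h.dualConn_eq_zero_iff]
        exact hX 1 le_rfl (by lia) _
      refine (ih (LinearMap.ker π) fun i hi hik ξ => ?_).congr
        ((LinearEquiv.ofTop _ htop).symm : Dual R (LinearMap.ker π) ≃ₗ[R] _)
      obtain ⟨i, rfl⟩ : ∃ i', i = i' + 1 := ⟨i - 1, by lia⟩
      exact ModExt.conn_injective_of_free h i
        ((hX (i + 1 + 1) (by lia) (by lia) _).trans (map_zero _).symm)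

theorem GorDim.isKSyzygy_iff_reflexive {k : ℕ} (hk : 3 ≤ k) (M : ModuleCat.{0} R)
    [Module.Finite R M] : IsKSyzygy R M k ↔ Module.IsReflexive R M ∧
      ∀ i, 1 ≤ i → i + 2 ≤ k → ∀ ξ : ModExt R (Dual R M) R i, ξ = 0 := by
  constructor
  · intro h
    refine ⟨?_, hG.ext_dual_eq_zero_of_isKSyzygy k M h⟩
    obtain ⟨k, rfl⟩ : ∃ k', k = k' + 2 := ⟨k - 2, by lia⟩
    exact hG.reflexive_of_isKSyzygy M h
  · rintro ⟨hr, hM⟩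
    exact (isKSyzygy_dual k (Dual R M) hM).congr (Module.evalEquiv R M).symm

end Syzygies

section LocalCohomology

variable {R : Type} [CommRing R]

/-- The projection between quotients by powers of `I`. -/
abbrev powProj (I : Ideal R) {n n' : ℕ} (h : n ≤ n') : (R ⧸ I ^ n') →ₗ[R] (R ⧸ I ^ n) :=
  Submodule.factor (Ideal.pow_le_pow_right h)

/-- A class in `Ext^i(R / I ^ n, N)` maps to zero in the limit over `n`. -/
def Dies (I : Ideal R) {N : Type} [AddCommGroup N] [Module R N] {i n : ℕ}
    (ξ : ModExt R (R ⧸ I ^ n) N i) : Prop :=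
  ∃ (n' : ℕ) (h : n ≤ n'), ModExt.pull (powProj I h) N i ξ = 0

open CategoryTheory.Limits in
theorem mem_annihilator_localCohomology_iff (I : Ideal R) (i : ℕ) (M : ModuleCat.{0} R) (x : R) :
    x ∈ Module.annihilator R ((localCohomology I i).obj M) ↔
      ∀ (n : ℕ) (ξ : ModExt R (R ⧸ I ^ n) M i), Dies I (x • ξ) := by
  obtain ⟨e, he⟩ := exists_natural_linearEquiv_ext M i
  let D := localCohomology.diagram (localCohomology.idealPowersDiagram I) i
  have : HasColimit D := localCohomology.hasColimitDiagram _ i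
  let t : Cocone (D ⋙ (evaluation _ _).obj M) :=
    ((evaluation (ModuleCat R) (ModuleCat R)).obj M).mapCocone (colimit.cocone D)
  have ht : IsColimit t :=
    isColimitOfPreserves ((evaluation (ModuleCat R) (ModuleCat R)).obj M) (colimit.isColimit D)
  have hpt : t.pt = (localCohomology I i).obj M := rfl
  rw [← hpt, Module.mem_annihilator]
  constructor
  · intro hx n ξ
    let y : ((Ext R (ModuleCat R) i).obj (op (ModuleCat.of R (R ⧸ I ^ n)))).obj M :=
      (e (ModuleCat.of R (R ⧸ I ^ n))).symm ξ
    have h0 : (t.ι.app (op (op n))).hom (x • y) = (t.ι.app (op (op n))).hom 0 :=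
      ((t.ι.app (op (op n))).hom.map_smul x y).trans
        ((hx ((t.ι.app (op (op n))).hom y)).trans (map_zero _).symm)
    obtain ⟨k, f, hf⟩ := (IsColimit.eq_iff' ht _ _).1 h0
    have hle : n ≤ k.unop.unop := f.unop.unop.down.down
    refine ⟨k.unop.unop, hle, ?_⟩
    have h1 := he _ _ (ModuleCat.ofHom (powProj I hle)) (x • y)
    have h2 : (((Ext R (ModuleCat R) i).map (ModuleCat.ofHom (powProj I hle)).op).app M).hom
        (x • y) = 0 := hf.trans (map_zero _)
    rw [h2, map_zero, map_smul] at h1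
    refine Eq.trans ?_ h1.symm
    have : (e (ModuleCat.of R (R ⧸ I ^ n))) y = ξ := LinearEquiv.apply_symm_apply _ _
    rw [this]
    rfl
  · intro h c
    obtain ⟨j, y, rfl⟩ := Concrete.isColimit_exists_rep _ ht c
    let y' : ((Ext R (ModuleCat R) i).obj (op (ModuleCat.of R (R ⧸ I ^ j.unop.unop)))).obj M := y
    obtain ⟨n', hle, hn'⟩ := h j.unop.unop (e (ModuleCat.of R (R ⧸ I ^ j.unop.unop)) y')
    have h1 := he _ _ (ModuleCat.ofHom (powProj I hle)) (x • y')
    have h2 : (((Ext R (ModuleCat R) i).map (ModuleCat.ofHom (powProj I hle)).op).app M).hom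
        (x • y') = 0 := by
      apply (e _).injective
      rw [h1, map_zero, map_smul]
      exact hn'
    have h3 : (t.ι.app j).hom (x • y') = (t.ι.app j).hom 0 :=
      (IsColimit.eq_iff' ht _ _).2 ⟨op (op n'), Quiver.Hom.op (Quiver.Hom.op (homOfLE hle)),
        h2.trans (map_zero _).symm⟩
    exact ((t.ι.app j).hom.map_smul x y').symm.trans (h3.trans (map_zero _))

end LocalCohomology

section Torsion

variable {R : Type} [CommRing R] {I : Ideal R}
variable {N N' : Type} [AddCommGroup N] [Module R N] [AddCommGroup N'] [Module R N']

theorem pull_powProj_pull {n n' n'' : ℕ} (h : n ≤ n') (h' : n' ≤ n'') {i : ℕ}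
    (ξ : ModExt R (R ⧸ I ^ n) N i) :
    ModExt.pull (powProj I h') N i (ModExt.pull (powProj I h) N i ξ) =
      ModExt.pull (powProj I (h.trans h')) N i ξ := by
  rw [← ModExt.pull_comp, Submodule.factor_comp]

theorem Dies.of_pull {n n' : ℕ} (h : n ≤ n') {i : ℕ} {ξ : ModExt R (R ⧸ I ^ n) N i}
    (H : Dies I (ModExt.pull (powProj I h) N i ξ)) : Dies I ξ := by
  obtain ⟨n'', h', hn⟩ := H
  exact ⟨n'', h.trans h', by rw [← pull_powProj_pull h h', hn]⟩

theorem Dies.push {n i : ℕ} {ξ : ModExt R (R ⧸ I ^ n) N i} (H : Dies I ξ) (g : N →ₗ[R] N') :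
    Dies I (ModExt.push _ g i ξ) := by
  obtain ⟨n', h, hn⟩ := H
  exact ⟨n', h, by rw [← ModExt.push_pull, hn, map_zero]⟩

theorem dies_zero {n i : ℕ} : Dies I (0 : ModExt R (R ⧸ I ^ n) N i) :=
  ⟨n, le_rfl, map_zero _⟩

theorem Dies.of_ses {A B C : Type} [AddCommGroup A] [Module R A] [AddCommGroup B] [Module R B]
    [AddCommGroup C] [Module R C] {f : A →ₗ[R] B} {g : B →ₗ[R] C} (h : IsSES R f g) {i n : ℕ}
    (hA : ∀ {n : ℕ} (η : ModExt R (R ⧸ I ^ n) A i), Dies I η) {ξ : ModExt R (R ⧸ I ^ n) B i}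
    (hξ : Dies I (ModExt.push _ g i ξ)) : Dies I ξ := by
  obtain ⟨n', hn, h0⟩ := hξ
  rw [← ModExt.push_pull] at h0
  obtain ⟨η, hη⟩ := ModExt.exists_push_eq h _ h0
  exact Dies.of_pull hn (hη ▸ (hA η).push f)

theorem Dies.coconn {A B C : Type} [AddCommGroup A] [Module R A] [AddCommGroup B] [Module R B]
    [AddCommGroup C] [Module R C] {f : A →ₗ[R] B} {g : B →ₗ[R] C} (h : IsSES R f g) {i n : ℕ}
    {ξ : ModExt R (R ⧸ I ^ n) C i} (hξ : Dies I ξ) : Dies I (ModExt.coconn h _ i ξ) := by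
  obtain ⟨n', hn, h0⟩ := hξ
  exact ⟨n', hn, by rw [← ModExt.coconn_pull, h0, map_zero]⟩

theorem isSES_pow (I : Ideal R) (n : ℕ) :
    IsSES R (Submodule.subtype (I ^ n)) (Submodule.mkQ (I ^ n)) :=
  isSES_mkQ _

theorem pull_eq_zero_of_forall_mem {X Z T : Type} [AddCommGroup X] [Module R X] [AddCommGroup Z]
    [Module R Z] [AddCommGroup T] [Module R T] {S : Submodule R X} {i : ℕ} {ξ : ModExt R X T i}
    (hξ : ModExt.pull S.subtype T i ξ = 0) (u : Z →ₗ[R] X) (hu : ∀ z, u z ∈ S) :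
    ModExt.pull u T i ξ = 0 := by
  have : u = S.subtype ∘ₗ u.codRestrict S hu := rfl
  rw [this, ModExt.pull_comp, hξ, map_zero]

variable [IsNoetherianRing R]

/-- A class in `Ext^i(X, T)`, with `T` killed by a power of `I`, restricts to zero on `I ^ n X` for
some `n`. -/
theorem exists_pull_pow_smul_eq_zero {T : Type} [AddCommGroup T] [Module R T] {c : ℕ}
    (hT : ∀ x ∈ I ^ c, ∀ t : T, x • t = 0) (i : ℕ) :
    ∀ (X : Type) [AddCommGroup X] [Module R X] [Module.Finite R X] (ξ : ModExt R X T i),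
      ∃ n, ModExt.pull (I ^ n • (⊤ : Submodule R X)).subtype T i ξ = 0 := by
  induction i with
  | zero =>
    intro X _ _ _ ξ
    refine ⟨c, ?_⟩
    obtain ⟨u, rfl⟩ := (ModExt.zeroEquiv R X T).symm.surjective ξ
    rw [ModExt.pull_zeroEquiv_symm]
    have h0 : u ∘ₗ (I ^ c • (⊤ : Submodule R X)).subtype = 0 := by
      ext ⟨a, ha⟩
      change u a = 0
      refine Submodule.smul_induction_on ha (fun r hr x _ => ?_) (fun x y hx hy => ?_)
      · rw [map_smul, hT r hr]
      · rw [map_add, hx, hy, add_zero]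
    rw [h0, map_zero]
  | succ i ih =>
    intro X _ _ _ ξ
    obtain ⟨r, g, h⟩ := exists_free_cover (R := R) X
    have := h.finite_left
    obtain ⟨η, rfl⟩ := ModExt.conn_surjective_of_free h _ ξ
    obtain ⟨n, hn⟩ := ih _ η
    obtain ⟨k, hk⟩ := Ideal.exists_pow_inf_eq_pow_smul I (LinearMap.ker g)
    refine ⟨n + k, ?_⟩
    let g' : ↥(I ^ (n + k) • (⊤ : Submodule R (Fin r → R)) : Submodule R _) →ₗ[R]
        ↥(I ^ (n + k) • (⊤ : Submodule R X) : Submodule R _) := g.restrict (fun v hv => by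
      have := Submodule.mem_map_of_mem (f := g) hv
      rw [Submodule.map_smul''] at this
      exact Submodule.smul_mono le_rfl le_top this)
    have hg' : Function.Surjective g' := by
      rintro ⟨v, hv⟩
      have htop : Submodule.map g ⊤ = ⊤ := by
        rw [Submodule.map_top, LinearMap.range_eq_top.2 h.2.1]
      rw [← htop, ← Submodule.map_smul''] at hv
      obtain ⟨w, hw, rfl⟩ := hv
      exact ⟨⟨w, hw⟩, rfl⟩
    have h' := isSES_ker g' hg'
    let a : LinearMap.ker g' →ₗ[R] LinearMap.ker g :=
      { toFun := fun v => ⟨v.1.1, congrArg Subtype.val v.2⟩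
        map_add' := fun _ _ => rfl
        map_smul' := fun _ _ => rfl }
    rw [ModExt.pull_conn_naturality h' h a (Submodule.subtype _) (Submodule.subtype _) rfl rfl,
      pull_eq_zero_of_forall_mem (Z := LinearMap.ker g') hn a, map_zero]
    intro v
    have hv : v.1.1 ∈ I ^ (n + k) • (⊤ : Submodule R (Fin r → R)) ⊓ LinearMap.ker g :=
      ⟨v.1.2, congrArg Subtype.val v.2⟩
    rw [hk (n + k) (by lia)] at hv
    have hv' := Submodule.smul_mono (le_refl (I ^ (n + k - k)))
      (inf_le_right : I ^ k • (⊤ : Submodule R (Fin r → R)) ⊓ LinearMap.ker g ≤ _) hv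
    rw [Nat.add_sub_cancel] at hv'
    have hmap : Submodule.map (LinearMap.ker g).subtype
        (I ^ n • (⊤ : Submodule R (LinearMap.ker g))) = I ^ n • LinearMap.ker g := by
      rw [Submodule.map_smul'', Submodule.map_top, Submodule.range_subtype]
    rw [← hmap] at hv'
    obtain ⟨w, hw, hwv⟩ := hv'
    have : a v = w := Subtype.ext hwv.symm
    exact this ▸ hw

theorem dies_of_torsion {T : Type} [AddCommGroup T] [Module R T] {c : ℕ}
    (hT : ∀ x ∈ I ^ c, ∀ t : T, x • t = 0) {i n : ℕ} (ξ : ModExt R (R ⧸ I ^ n) T (i + 1)) :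
    Dies I ξ := by
  obtain ⟨η, rfl⟩ := ModExt.conn_surjective_of_free (isSES_pow I n) _ ξ
  obtain ⟨m, hm⟩ := exists_pull_pow_smul_eq_zero hT i _ η
  refine ⟨n + m, by lia, ?_⟩
  let a : (I ^ (n + m) : Ideal R) →ₗ[R] (I ^ n : Ideal R) :=
    Submodule.inclusion (Ideal.pow_le_pow_right (by lia))
  rw [ModExt.pull_conn_naturality (isSES_pow I (n + m)) (isSES_pow I n) a LinearMap.id _ rfl rfl,
    pull_eq_zero_of_forall_mem hm a, map_zero]
  rintro ⟨v, hv⟩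
  have hmap : Submodule.map (Submodule.subtype (I ^ n))
      (I ^ m • (⊤ : Submodule R (I ^ n : Ideal R))) = I ^ (n + m) := by
    rw [Submodule.map_smul'', Submodule.map_top, Submodule.range_subtype, smul_eq_mul,
      ← pow_add, add_comm]
  have hv' := hv
  rw [← hmap] at hv'
  obtain ⟨w, hw, hwv⟩ := hv'
  have : a ⟨v, hv⟩ = w := Subtype.ext hwv.symm
  exact this ▸ hw

variable [IsLocalRing R]

local notation "𝔪" => IsLocalRing.maximalIdeal R

omit [IsNoetherianRing R] [IsLocalRing R] in
theorem pow_smul_modExt_eq_zero {x : R} (hx : x ∈ I) {n i : ℕ} (ξ : ModExt R (R ⧸ I ^ n) N i) :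
    x ^ n • ξ = 0 := by
  refine ModExt.smul_eq_zero_of_left _ (fun a => ?_) i ξ
  have : x ^ n ∈ Module.annihilator R (R ⧸ I ^ n) := by
    rw [Ideal.annihilator_quotient]
    exact Ideal.pow_mem_pow hx n
  exact Module.mem_annihilator.1 this a

/-- Vanishing of local cohomology above the dimension. -/
theorem dies_of_dimLT (N : Type) [AddCommGroup N] [Module R N] [Module.Finite R N] {i : ℕ}
    (hN : DimLT R N i) {n : ℕ} (ξ : ModExt R (R ⧸ 𝔪 ^ n) N i) : Dies 𝔪 ξ := by
  revert i n
  refine devissage (R := R) (P := fun N _ _ => ∀ {i : ℕ} (_ : DimLT R N i) {n : ℕ}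
    (ξ : ModExt R (R ⧸ 𝔪 ^ n) N i), Dies 𝔪 ξ) ?_ ?_ ?_ N
  · intro N _ _ _ i _ n ξ
    rw [← one_smul R ξ, ModExt.smul_eq_zero_of_right 1 (fun a => Subsingleton.elim _ _) i ξ]
    exact dies_zero
  · intro A B C _ _ _ _ _ _ _ _ _ f g hs hA hC i hB n ξ
    exact Dies.of_ses hs (fun η => hA (hB.of_injective f hs.1) η)
      (hC (hB.of_surjective g hs.2.1) _)
  · intro p _ H i hi n ξ
    cases i with
    | zero =>
      have := dimLT_zero_iff.1 hi
      rw [← one_smul R ξ, ModExt.smul_eq_zero_of_right 1 (fun a => Subsingleton.elim _ _) _ ξ]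
      exact dies_zero
    | succ i =>
      by_cases hp : p = 𝔪
      · subst hp
        refine dies_of_torsion (c := 1) (fun x hx t => ?_) ξ
        rw [pow_one, ← Ideal.annihilator_quotient (I := 𝔪)] at hx
        exact Module.mem_annihilator.1 hx t
      · obtain ⟨x, hx, hxp⟩ := exists_mem_maximalIdeal_notMem hp
        have key : ∀ (a n : ℕ) (ξ : ModExt R (R ⧸ 𝔪 ^ n) (R ⧸ p) (i + 1)), x ^ a • ξ = 0 →
            Dies 𝔪 ξ := by
          intro a
          induction a with
          | zero =>
            intro n ξ h
            rw [pow_zero, one_smul] at h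
            exact h ▸ dies_zero
          | succ a ih =>
            intro n ξ h
            obtain ⟨n', hn, h0⟩ := ih n (x • ξ) (by rw [smul_smul, ← pow_succ, h])
            refine Dies.of_pull hn ?_
            obtain ⟨η, hη⟩ := ModExt.exists_coconn_eq (isSES_prime p x hxp)
              (ModExt.pull (powProj 𝔪 hn) _ _ ξ) (by rw [← ModExt.smul_eq_push, ← map_smul, h0])
            rw [← hη]
            refine Dies.coconn _ (H _ (prime_lt_annihilator hxp) ?_ η)
            rw [DimLT, Ideal.annihilator_quotient] at hi
            exact hi.of_prime_lt (prime_lt_annihilator hxp)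
        exact key n n ξ (pow_smul_modExt_eq_zero hx ξ)

end Torsion

namespace ModExt

variable {R : Type} [CommRing R] {A A' B B' : Type} [AddCommGroup A] [Module R A] [AddCommGroup A']
  [Module R A'] [AddCommGroup B] [Module R B] [AddCommGroup B'] [Module R B'] {i : ℕ}

/-- Pullback of a fixed class, as a linear function of the map. -/
noncomputable def pullHom (ξ : ModExt R A' B i) : (A →ₗ[R] A') →ₗ[R] ModExt R A B i where
  toFun f := pull f B i ξ
  map_add' f g := pull_add f g i ξ
  map_smul' x f := pull_smul x f i ξ

/-- Pushforward of a fixed class, as a linear function of the map. -/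
noncomputable def pushHom (ξ : ModExt R A B i) : (B →ₗ[R] B') →ₗ[R] ModExt R A B' i where
  toFun f := push A f i ξ
  map_add' f g := push_add f g i ξ
  map_smul' x f := push_smul x f i ξ

theorem pull_sum {ι : Type} (s : Finset ι) (f : ι → A →ₗ[R] A') (ξ : ModExt R A' B i) :
    pull (∑ j ∈ s, f j) B i ξ = ∑ j ∈ s, pull (f j) B i ξ :=
  map_sum (pullHom ξ) f s

theorem push_sum {ι : Type} (s : Finset ι) (f : ι → B →ₗ[R] B') (ξ : ModExt R A B i) :
    push A (∑ j ∈ s, f j) i ξ = ∑ j ∈ s, push A (f j) i ξ :=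
  map_sum (pushHom ξ) f s

theorem sum_single_proj {r : ℕ} : (∑ j, LinearMap.single R (fun _ : Fin r => A) j ∘ₗ
    LinearMap.proj j) = (LinearMap.id : (Fin r → A) →ₗ[R] (Fin r → A)) := by
  ext j a k
  simp

theorem eq_sum_pull {r : ℕ} (ξ : ModExt R (Fin r → A) B i) :
    ξ = ∑ j, pull (LinearMap.proj j) B i
      (pull (LinearMap.single R (fun _ : Fin r => A) j) B i ξ) := by
  conv_lhs => rw [← pull_id i ξ, ← sum_single_proj, pull_sum]
  simp_rw [pull_comp]

theorem eq_sum_push {r : ℕ} (ξ : ModExt R A (Fin r → B) i) :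
    ξ = ∑ j, push A (LinearMap.single R (fun _ : Fin r => B) j) i
      (push A (LinearMap.proj j) i ξ) := by
  conv_lhs => rw [← push_id i ξ, ← sum_single_proj, push_sum]
  simp_rw [push_comp]

end ModExt

section LocalDuality

variable {R : Type} [CommRing R] [IsLocalRing R]

local notation "𝔪" => IsLocalRing.maximalIdeal R

open Module (Dual)

/-- `N` is killed by the `n`-th power of the maximal ideal. -/
def KilledByPow (R : Type) [CommRing R] [IsLocalRing R] (n : ℕ) (N : Type) [AddCommGroup N]
    [Module R N] : Prop :=
  ∀ x ∈ IsLocalRing.maximalIdeal R ^ n, ∀ a : N, x • a = 0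

variable {N L : Type} [AddCommGroup N] [Module R N] [AddCommGroup L] [Module R L] {n : ℕ}

theorem KilledByPow.of_injective (h : KilledByPow R n L) (f : N →ₗ[R] L)
    (hf : Function.Injective f) : KilledByPow R n N :=
  fun x hx a => hf (by rw [map_smul, h x hx, map_zero])

theorem killedByPow_quotient (n : ℕ) : KilledByPow R n (R ⧸ 𝔪 ^ n) := fun x hx a => by
  rw [← Ideal.annihilator_quotient (I := 𝔪 ^ n)] at hx
  exact Module.mem_annihilator.1 hx a

theorem killedByPow_modExt (n i : ℕ) : KilledByPow R n (ModExt R (R ⧸ 𝔪 ^ n) N i) :=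
  fun x hx => ModExt.smul_eq_zero_of_left x (killedByPow_quotient n x hx) i

theorem KilledByPow.dimLT_one (h : KilledByPow R n N) : DimLT R N 1 := by
  intro l hl
  have key : ∀ j, (l j).asIdeal = 𝔪 := fun j => by
    refine le_antisymm (IsLocalRing.le_maximalIdeal (l j).isPrime.ne_top) ?_
    refine ((l j).isPrime.pow_le_iff (n := n + 1) (by lia)).1 ?_
    refine le_trans ?_ (l.monotone (Fin.zero_le j) : l.head.asIdeal ≤ (l j).asIdeal)
    refine le_trans (fun x hx => ?_) hl
    exact Module.mem_annihilator.2 (h x (Ideal.pow_le_pow_right (by lia) hx))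
  by_contra hlen
  have hlt := l.step ⟨0, by lia⟩
  exact hlt.ne (PrimeSpectrum.ext ((key _).trans (key _).symm))

/-- The map `R / 𝔪 ^ n → L` sending `1` to `a`, for `L` killed by `𝔪 ^ n`. -/
noncomputable def KilledByPow.pt (h : KilledByPow R n L) : L →ₗ[R] (R ⧸ 𝔪 ^ n) →ₗ[R] L where
  toFun a := Submodule.liftQ _ (LinearMap.toSpanSingleton R L a) (fun x hx => h x hx a)
  map_add' a b := by
    apply LinearMap.ext
    rintro ⟨r⟩
    exact smul_add r a b
  map_smul' x a := by
    apply LinearMap.ext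
    rintro ⟨r⟩
    exact smul_comm r x a

theorem KilledByPow.pt_mk (h : KilledByPow R n L) (a : L) (r : R) :
    h.pt a (Ideal.Quotient.mk _ r) = r • a := rfl

theorem KilledByPow.comp_pt (hL : KilledByPow R n L) (hN : KilledByPow R n N) (f : L →ₗ[R] N)
    (a : L) : f ∘ₗ hL.pt a = hN.pt (f a) := by
  apply LinearMap.ext
  intro y
  obtain ⟨r, rfl⟩ := Ideal.Quotient.mk_surjective y
  exact map_smul f r a

theorem KilledByPow.eq_pt (h : KilledByPow R n L) (u : (R ⧸ 𝔪 ^ n) →ₗ[R] L) : u = h.pt (u 1) := by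
  apply LinearMap.ext
  intro y
  obtain ⟨r, rfl⟩ := Ideal.Quotient.mk_surjective y
  rw [h.pt_mk, ← map_smul, Algebra.smul_def, mul_one]
  rfl

theorem pull_pt_quotient (r : R) {i : ℕ} (ξ : ModExt R (R ⧸ 𝔪 ^ n) N i) :
    ModExt.pull ((killedByPow_quotient n).pt (Ideal.Quotient.mk _ r)) N i ξ = r • ξ := by
  have : (r • LinearMap.id : (R ⧸ 𝔪 ^ n) →ₗ[R] (R ⧸ 𝔪 ^ n)) 1 = Ideal.Quotient.mk _ r := by
    rw [LinearMap.smul_apply, LinearMap.id_apply, Algebra.smul_def, mul_one]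
    rfl
  rw [← this, ← KilledByPow.eq_pt, ModExt.smul_eq_pull]

theorem exists_cover_of_killedByPow [Module.Finite R L] (h : KilledByPow R n L) :
    ∃ (r : ℕ) (g : (Fin r → R ⧸ 𝔪 ^ n) →ₗ[R] L), Function.Surjective g := by
  obtain ⟨r, g, hg⟩ := Module.Finite.exists_fin' R L
  refine ⟨r, ∑ j, h.pt (g (Pi.single j 1)) ∘ₗ LinearMap.proj j, fun l => ?_⟩
  obtain ⟨v, rfl⟩ := hg l
  refine ⟨fun j => Ideal.Quotient.mk _ (v j), ?_⟩
  simp only [LinearMap.sum_apply, LinearMap.comp_apply, LinearMap.proj_apply, h.pt_mk]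
  conv_rhs => rw [pi_eq_sum_univ' v, map_sum]
  refine Finset.sum_congr rfl fun j _ => ?_
  rw [map_smul]

namespace GorDim

variable [IsNoetherianRing R] {d : ℕ} (hG : GorDim R d)
include hG

omit [IsNoetherianRing R] in
/-- `Ext^d(-, R)` takes injections to surjections. -/
theorem pull_surjective [Module.Finite R L] (f : N →ₗ[R] L) (hf : Function.Injective f) :
    Function.Surjective (ModExt.pull f R d) := fun ξ =>
  ModExt.exists_pull_eq_of_conn (isSES_range f hf) ξ (hG.vanish _ (d + 1) (by lia) _)

/-- `Ext^d(-, R)` takes surjections of finite length modules to injections. -/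
theorem pull_injective [Module.Finite R N] (hN : KilledByPow R n N) (f : N →ₗ[R] L)
    (hf : Function.Surjective f) : Function.Injective (ModExt.pull f R d) := by
  rw [injective_iff_map_eq_zero]
  intro ξ hξ
  cases d with
  | zero =>
    have := ModExt.zeroEquiv_pull f ξ
    rw [hξ, map_zero] at this
    refine (ModExt.zeroEquiv R L R).injective ?_
    rw [map_zero]
    exact LinearMap.cancel_right hf |>.1 this.symm
  | succ d =>
    obtain ⟨η, rfl⟩ := ModExt.exists_conn_eq (isSES_ker f hf) ξ hξ
    rw [hG.ext_eq_zero _ 1 d (hN.of_injective _ (Submodule.injective_subtype _)).dimLT_one (by lia)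
      η, map_zero]

theorem eq_zero_of_forall_pt [Module.Finite R L] (h : KilledByPow R n L) (ξ : ModExt R L R d)
    (hξ : ∀ a, ModExt.pull (h.pt a) R d ξ = 0) : ξ = 0 := by
  obtain ⟨r, g, hg⟩ := exists_cover_of_killedByPow h
  have hP : KilledByPow R n (Fin r → R ⧸ 𝔪 ^ n) :=
    fun x hx a => funext fun j => killedByPow_quotient n x hx (a j)
  refine hG.pull_injective hP g hg ?_
  rw [map_zero, ModExt.eq_sum_pull (ModExt.pull g R d ξ)]
  refine Finset.sum_eq_zero fun j _ => ?_
  have := h.eq_pt (g ∘ₗ LinearMap.single R (fun _ : Fin r => R ⧸ 𝔪 ^ n) j)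
  rw [← ModExt.pull_comp _ g, this, hξ, map_zero]

theorem exists_pull_pt_eq [Module.Finite R L] (h : KilledByPow R n L)
    (g : L →ₗ[R] ModExt R (R ⧸ 𝔪 ^ n) R d) :
    ∃ ξ : ModExt R L R d, ∀ a, ModExt.pull (h.pt a) R d ξ = g a := by
  obtain ⟨r, π, hπ⟩ := exists_cover_of_killedByPow h
  have hP : KilledByPow R n (Fin r → R ⧸ 𝔪 ^ n) :=
    fun x hx a => funext fun j => killedByPow_quotient n x hx (a j)
  let ξ : ModExt R (Fin r → R ⧸ 𝔪 ^ n) R d :=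
    ∑ j, ModExt.pull (LinearMap.proj j) R d (g (π (Pi.single j 1)))
  have hξ : ∀ p, ModExt.pull (hP.pt p) R d ξ = g (π p) := by
    intro p
    choose x hx using fun j => Ideal.Quotient.mk_surjective (p j)
    have hp : p = ∑ j, x j • Pi.single j (1 : R ⧸ 𝔪 ^ n) := by
      ext k
      rw [Finset.sum_apply, Finset.sum_eq_single k, Pi.smul_apply, Pi.single_eq_same,
        Algebra.smul_def, mul_one, ← hx]
      · rfl
      · intro j _ hj
        rw [Pi.smul_apply, Pi.single_eq_of_ne hj.symm, smul_zero]
      · simp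
    rw [map_sum]
    conv_rhs => rw [hp, map_sum, map_sum]
    refine Finset.sum_congr rfl fun j _ => ?_
    rw [← ModExt.pull_comp, hP.comp_pt (killedByPow_quotient n), LinearMap.proj_apply, ← hx,
      pull_pt_quotient, map_smul, map_smul]
  have hK := hP.of_injective _ (Submodule.injective_subtype (LinearMap.ker π))
  obtain ⟨η, hη⟩ := ModExt.exists_pull_eq (isSES_ker π hπ) ξ
    (hG.eq_zero_of_forall_pt hK _ fun a => by
      rw [← ModExt.pull_comp, hK.comp_pt hP, hξ]
      exact (congrArg g a.2).trans (map_zero g))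
  refine ⟨η, fun a => ?_⟩
  obtain ⟨p, rfl⟩ := hπ a
  rw [← hξ, ← hη, ← ModExt.pull_comp, hP.comp_pt h]

theorem pull_powProj_injective {n n' : ℕ} (h : n ≤ n') :
    Function.Injective (ModExt.pull (powProj 𝔪 h) R d) :=
  hG.pull_injective (killedByPow_quotient n') _ (Submodule.factor_surjective _)

omit hG in
/-- A map from a submodule to a module killed by a power of `𝔪` is continuous for the `𝔪`-adic
topology of the ambient module. -/
theorem exists_submodule_killedByPow {X Y T : Type} [AddCommGroup X] [Module R X] [AddCommGroup Y]
    [Module R Y] [Module.Finite R Y] [AddCommGroup T] [Module R T] (f : X →ₗ[R] Y)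
    (hf : Function.Injective f) (hT : KilledByPow R n T) (g : X →ₗ[R] T) :
    ∃ (m : ℕ) (_ : n ≤ m) (S : Submodule R Y), KilledByPow R m (Y ⧸ S) ∧
      ∀ x, f x ∈ S → g x = 0 := by
  obtain ⟨k, hk⟩ := Ideal.exists_pow_inf_eq_pow_smul 𝔪 (LinearMap.range f)
  refine ⟨n + k, Nat.le_add_right n k, 𝔪 ^ (n + k) • ⊤, ?_, ?_⟩
  · intro x hx a
    obtain ⟨y, rfl⟩ := Submodule.mkQ_surjective _ a
    rw [← map_smul, Submodule.mkQ_apply, Submodule.Quotient.mk_eq_zero]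
    exact Submodule.smul_mem_smul hx trivial
  · intro x hx
    have hx' : f x ∈ 𝔪 ^ (n + k) • ⊤ ⊓ LinearMap.range f := ⟨hx, x, rfl⟩
    have hx2 : f x ∈ 𝔪 ^ n • LinearMap.range f := by
      rw [hk (n + k) (by lia), Nat.add_sub_cancel] at hx'
      exact Submodule.smul_mono le_rfl inf_le_right hx'
    rw [← Submodule.map_top, ← Submodule.map_smul''] at hx2
    obtain ⟨z, hz, hzx⟩ := hx2
    obtain rfl := hf hzx
    refine Submodule.smul_induction_on hz (fun r hr x _ => ?_) (fun x y hx hy => ?_)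
    · rw [map_smul, hT r hr]
    · rw [map_add, hx, hy, add_zero]

theorem exists_extension_of_injective {X Y : Type} [AddCommGroup X] [Module R X] [AddCommGroup Y]
    [Module R Y] [Module.Finite R Y] (f : X →ₗ[R] Y) (hf : Function.Injective f)
    (g : X →ₗ[R] ModExt R (R ⧸ 𝔪 ^ n) R d) :
    ∃ (n' : ℕ) (h : n ≤ n') (g' : Y →ₗ[R] ModExt R (R ⧸ 𝔪 ^ n') R d),
      ∀ x, g' (f x) = ModExt.pull (powProj 𝔪 h) R d (g x) := by
  obtain ⟨m, hm, S, hY, hS⟩ := exists_submodule_killedByPow f hf (killedByPow_modExt n d) g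
  have hQ := hY.of_injective (LinearMap.range (S.mkQ ∘ₗ f)).subtype
    (Submodule.injective_subtype _)
  obtain ⟨v, hv⟩ := exists_comp_eq_of_surjective
    (isSES_ker (S.mkQ ∘ₗ f).rangeRestrict (LinearMap.surjective_rangeRestrict _)) g (by
      apply LinearMap.ext
      rintro ⟨x, hx⟩
      exact hS x ((Submodule.Quotient.mk_eq_zero S).1 (congrArg Subtype.val hx)))
  obtain ⟨ξ, hξ⟩ := hG.exists_pull_pt_eq hQ (ModExt.pull (powProj 𝔪 hm) R d ∘ₗ v)
  obtain ⟨η, rfl⟩ := hG.pull_surjective _ (Submodule.injective_subtype _) ξ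
  refine ⟨m, hm, ModExt.pullHom η ∘ₗ hY.pt ∘ₗ S.mkQ, fun x => ?_⟩
  have := hξ ((S.mkQ ∘ₗ f).rangeRestrict x)
  rw [← ModExt.pull_comp, hQ.comp_pt hY] at this
  have hvx : v ((S.mkQ ∘ₗ f).rangeRestrict x) = g x := LinearMap.congr_fun hv x
  rw [LinearMap.comp_apply, hvx] at this
  exact this

/-- The direct limit of the modules `Ext^d(R / 𝔪 ^ n, R)` is injective with respect to maps of
finite modules. -/
theorem exists_extension {X Y : Type} [AddCommGroup X] [Module R X] [AddCommGroup Y]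
    [Module R Y] [Module.Finite R Y] (f : X →ₗ[R] Y)
    (g : X →ₗ[R] ModExt R (R ⧸ 𝔪 ^ n) R d) (hfg : ∀ x, f x = 0 → g x = 0) :
    ∃ (n' : ℕ) (h : n ≤ n') (g' : Y →ₗ[R] ModExt R (R ⧸ 𝔪 ^ n') R d),
      ∀ x, g' (f x) = ModExt.pull (powProj 𝔪 h) R d (g x) := by
  obtain ⟨v, hv⟩ := exists_comp_eq_of_surjective
    (isSES_ker f.rangeRestrict (LinearMap.surjective_rangeRestrict _)) g (by
      ext ⟨x, hx⟩
      exact hfg x (congrArg Subtype.val hx))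
  obtain ⟨n', h, g', hg'⟩ := hG.exists_extension_of_injective (LinearMap.range f).subtype
    (Submodule.injective_subtype _) v
  exact ⟨n', h, g', fun x => (hg' (f.rangeRestrict x)).trans
    (congrArg _ (LinearMap.congr_fun hv x))⟩

/-- The direct limit of the modules `Ext^d(R / 𝔪 ^ n, R)` is a cogenerator. -/
theorem exists_map_ne_zero {W : Type} [AddCommGroup W] [Module R W] [Module.Finite R W] {w : W}
    (hw : w ≠ 0) : ∃ (n : ℕ) (g : W →ₗ[R] ModExt R (R ⧸ 𝔪 ^ n) R d), g w ≠ 0 := by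
  obtain ⟨ξ, hξ⟩ := hG.nontriv
  let u : (R ⧸ 𝔪 ^ 1) →ₗ[R] (R ⧸ 𝔪) := Submodule.factor (by rw [pow_one])
  have he : ModExt.pull u R d ξ ≠ 0 := fun h =>
    hξ (hG.pull_injective (killedByPow_quotient 1) u (Submodule.factor_surjective _)
      (h.trans (map_zero _).symm))
  obtain ⟨n, h, g, hg⟩ := hG.exists_extension (LinearMap.toSpanSingleton R W w)
    (LinearMap.toSpanSingleton R _ (ModExt.pull u R d ξ)) (fun x hx => by
      refine killedByPow_modExt 1 d x ?_ _
      rw [pow_one, IsLocalRing.mem_maximalIdeal]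
      intro hu
      exact hw ((hu.smul_eq_zero).1 hx))
  refine ⟨n, g, fun h0 => he (hG.pull_powProj_injective h ?_)⟩
  have := hg 1
  rw [LinearMap.toSpanSingleton_apply, LinearMap.toSpanSingleton_apply, one_smul, one_smul,
    h0] at this
  rw [← this, map_zero]

end GorDim
end LocalDuality

section LocalDuality

variable {R : Type} [CommRing R] [IsLocalRing R]

local notation "𝔪" => IsLocalRing.maximalIdeal R

open Module (Dual)

variable {n : ℕ}

omit [IsLocalRing R] in
theorem ModExt.eq_zero_of_forall_push {X : Type} [AddCommGroup X] [Module R X] {r i : ℕ}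
    (ξ : ModExt R X (Fin r → R) i) (hξ : ∀ φ : Dual R (Fin r → R), ModExt.push X φ i ξ = 0) :
    ξ = 0 := by
  rw [ModExt.eq_sum_push ξ]
  refine Finset.sum_eq_zero fun j _ => ?_
  rw [hξ, map_zero]

omit [IsLocalRing R] in
theorem ModExt.exists_push_eq_of_free {X : Type} [AddCommGroup X] [Module R X] {r i : ℕ}
    (g : Dual R (Fin r → R) →ₗ[R] ModExt R X R i) :
    ∃ ξ : ModExt R X (Fin r → R) i, ∀ φ, ModExt.push X φ i ξ = g φ := by
  refine ⟨∑ j, ModExt.push X (LinearMap.single R (fun _ : Fin r => R) j) i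
    (g (LinearMap.proj j)), fun φ => ?_⟩
  have hφ : φ = ∑ j, φ (Pi.single j 1) • (LinearMap.proj j : Dual R (Fin r → R)) := by
    ext j
    simp [Pi.single_apply]
  rw [map_sum]
  conv_rhs => rw [hφ, map_sum]
  refine Finset.sum_congr rfl fun j _ => ?_
  have : φ ∘ₗ LinearMap.single R (fun _ : Fin r => R) j =
      φ (Pi.single j 1) • (LinearMap.id : R →ₗ[R] R) := by
    ext
    simp
  rw [← ModExt.push_comp, this, ← ModExt.smul_eq_push, map_smul]

namespace GorDim

variable [IsNoetherianRing R] {d : ℕ} (hG : GorDim R d)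
include hG

theorem ext_quotient_free_eq_zero {r i : ℕ} (hi : i < d)
    (ξ : ModExt R (R ⧸ 𝔪 ^ n) (Fin r → R) i) : ξ = 0 :=
  ModExt.eq_zero_of_forall_push ξ fun φ =>
    hG.ext_eq_zero _ 1 i (killedByPow_quotient n).dimLT_one (by lia) _

theorem dimLT_succ (N : Type) [AddCommGroup N] [Module R N] : DimLT R N (d + 1) := by
  refine IdealDimLT.mono_left bot_le (fun l _ => ?_)
  have h : (l.length : WithBot ℕ∞) ≤ (d : WithBot ℕ∞) :=
    (Order.LTSeries.length_le_krullDim l).trans hG.ringKrullDim_eq.le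
  exact Nat.lt_succ_of_le (by exact_mod_cast h)

section

variable (N : Type) [AddCommGroup N] [Module R N] [Module.Finite R N]

theorem exists_push_eq_pull (g : Dual R N →ₗ[R] ModExt R (R ⧸ 𝔪 ^ n) R d) :
    ∃ (n' : ℕ) (h : n ≤ n') (ξ : ModExt R (R ⧸ 𝔪 ^ n') N d),
      ∀ φ : Dual R N, ModExt.push _ φ d ξ = ModExt.pull (powProj 𝔪 h) R d (g φ) := by
  obtain ⟨r, p, hs⟩ := exists_free_cover (R := R) N
  obtain ⟨n', h, g', hg'⟩ := hG.exists_extension p.dualMap g (fun φ hφ => by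
    rw [LinearMap.dualMap_injective_of_surjective hs.2.1 (hφ.trans (map_zero _).symm), map_zero])
  obtain ⟨ξ, hξ⟩ := ModExt.exists_push_eq_of_free g'
  refine ⟨n', h, ModExt.push _ p d ξ, fun φ => ?_⟩
  rw [← ModExt.push_comp, hξ]
  exact hg' φ

theorem dies_of_forall_push (ξ : ModExt R (R ⧸ 𝔪 ^ n) N d)
    (hξ : ∀ φ : Dual R N, ModExt.push _ φ d ξ = 0) : Dies 𝔪 ξ := by
  obtain ⟨r, p, hs⟩ := exists_free_cover (R := R) N
  have := hs.finite_left
  obtain ⟨n₁, h₁, hn₁⟩ := dies_of_dimLT _ (hG.dimLT_succ _) (ModExt.coconn hs _ d ξ)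
  rw [← ModExt.coconn_pull] at hn₁
  obtain ⟨ζ, hζ⟩ := ModExt.exists_push_eq_of_coconn hs _ hn₁
  obtain ⟨n₂, h₂, g, hg⟩ := hG.exists_extension (LinearMap.ker p).subtype.dualMap
    (ModExt.pushHom (B' := R) ζ) (fun φ hφ => by
      obtain ⟨ψ, rfl⟩ := exists_comp_eq_of_surjective hs φ hφ
      change ModExt.push _ (ψ ∘ₗ p) d ζ = 0
      rw [ModExt.push_comp, hζ, ModExt.push_pull, hξ, map_zero])
  obtain ⟨n₃, h₃, η, hη⟩ := hG.exists_push_eq_pull _ g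
  have key : ModExt.pull (powProj 𝔪 (h₂.trans h₃)) _ d ζ =
      ModExt.push _ (LinearMap.ker p).subtype d η := by
    rw [← sub_eq_zero]
    refine ModExt.eq_zero_of_forall_push _ fun φ => ?_
    have h4 : g (φ ∘ₗ (LinearMap.ker p).subtype) =
      ModExt.pull (powProj 𝔪 h₂) R d (ModExt.push _ φ d ζ) := hg φ
    rw [map_sub, ModExt.push_pull, ← ModExt.push_comp, hη, h4, pull_powProj_pull, sub_self]
  refine ⟨n₃, h₁.trans (h₂.trans h₃), ?_⟩
  rw [← pull_powProj_pull h₁ (h₂.trans h₃), ← hζ, ← ModExt.push_pull, key,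
    ModExt.push_push_eq_zero hs]

end

section

variable {N M : Type} [AddCommGroup N] [Module R N] [AddCommGroup M] [Module R M] {r : ℕ}
  {f : N →ₗ[R] (Fin r → R)} {p : (Fin r → R) →ₗ[R] M}

theorem dies_of_dies_coconn (hs : IsSES R f p) {i : ℕ} (hi : i < d)
    {ξ : ModExt R (R ⧸ 𝔪 ^ n) M i} (hξ : Dies 𝔪 (ModExt.coconn hs _ i ξ)) : Dies 𝔪 ξ := by
  obtain ⟨n', h, hn⟩ := hξ
  rw [← ModExt.coconn_pull] at hn
  obtain ⟨η, hη⟩ := ModExt.exists_push_eq_of_coconn hs _ hn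
  exact ⟨n', h, by rw [← hη, hG.ext_quotient_free_eq_zero hi η, map_zero]⟩

theorem dies_smul_of_ext_one [Module.Finite R N] (hs : IsSES R f p) {x : R} {i : ℕ}
    (hd : i + 1 = d) (hx : ∀ ξ : ModExt R M R 1, x • ξ = 0) (ξ : ModExt R (R ⧸ 𝔪 ^ n) M i) :
    Dies 𝔪 (x • ξ) := by
  refine hG.dies_of_dies_coconn hs (by lia) ?_
  subst hd
  refine hG.dies_of_forall_push N _ fun φ => ?_
  have h0 : hs.dualConn (x • φ) = 0 := by rw [map_smul, hx]
  obtain ⟨ψ, hψ⟩ := (hs.dualConn_eq_zero_iff _).1 h0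
  have hψ' : ψ ∘ₗ f = x • φ := hψ
  rw [map_smul, map_smul, ← ModExt.push_smul, ← hψ', ModExt.push_comp, ModExt.push_coconn,
    map_zero]

theorem smul_ext_one_eq_zero_of_dies [Module.Finite R N] (hs : IsSES R f p) {x : R} {i : ℕ}
    (hd : i + 1 = d) (hx : ∀ n (ξ : ModExt R (R ⧸ 𝔪 ^ n) M i), Dies 𝔪 (x • ξ))
    (ω : ModExt R M R 1) : x • ω = 0 := by
  have : Module.Finite R M := hs.finite_right
  subst hd
  by_contra hω
  obtain ⟨φ, rfl⟩ := hs.dual_range.2.1 ω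
  obtain ⟨n, g, hg⟩ := hG.exists_map_ne_zero hω
  obtain ⟨n₁, h₁, ξ, hξ⟩ := hG.exists_push_eq_pull N (g ∘ₗ hs.dualConn)
  obtain ⟨η, rfl⟩ := ModExt.exists_coconn_eq hs ξ (ModExt.eq_zero_of_forall_push _ fun ψ => by
    rw [← ModExt.push_comp, hξ, LinearMap.comp_apply,
      (hs.dualConn_eq_zero_iff (ψ ∘ₗ f)).2 ⟨ψ, rfl⟩, map_zero, map_zero])
  obtain ⟨n₂, h₂, h0⟩ := (hx n₁ η).coconn hs
  rw [map_smul] at h0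
  refine hg (hG.pull_powProj_injective (h₁.trans h₂) ?_)
  have h3 := hξ (x • φ)
  rw [ModExt.push_smul, LinearMap.comp_apply, map_smul hs.dualConn,
    ← map_smul (ModExt.push _ φ (i + 1))] at h3
  rw [← pull_powProj_pull h₁ h₂, ← h3, ← ModExt.push_pull, h0, map_zero, map_zero]

end

/-- The form of local duality needed here: `Ext^j(M, R)` and `H^i_𝔪(M)`, `i + j = d`, have the same
annihilator. -/
theorem smul_ext_eq_zero_iff_dies {x : R} (j : ℕ) : ∀ (i : ℕ), i + (j + 1) = d →
    ∀ (M : Type) [AddCommGroup M] [Module R M] [Module.Finite R M],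
      (∀ ω : ModExt R M R (j + 1), x • ω = 0) ↔
        ∀ n (ξ : ModExt R (R ⧸ 𝔪 ^ n) M i), Dies 𝔪 (x • ξ) := by
  induction j with
  | zero =>
    intro i hd M _ _ _
    obtain ⟨r, p, hs⟩ := exists_free_cover (R := R) M
    have := hs.finite_left
    exact ⟨fun hx n ξ => hG.dies_smul_of_ext_one hs hd hx ξ,
      hG.smul_ext_one_eq_zero_of_dies hs hd⟩
  | succ j ih =>
    intro i hd M _ _ _
    obtain ⟨r, p, hs⟩ := exists_free_cover (R := R) M
    have := hs.finite_left
    have hext : (∀ ω : ModExt R M R (j + 1 + 1), x • ω = 0) ↔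
        ∀ ω : ModExt R (LinearMap.ker p) R (j + 1), x • ω = 0 := by
      constructor
      · intro h ω
        refine ModExt.conn_injective_of_free hs j ?_
        rw [map_smul, h, map_zero]
      · intro h ω
        obtain ⟨ω, rfl⟩ := ModExt.conn_surjective_of_free hs _ ω
        rw [← map_smul, h, map_zero]
    rw [hext, ih (i + 1) (by lia)]
    constructor
    · intro h n ξ
      refine hG.dies_of_dies_coconn hs (by lia) ?_
      rw [map_smul]
      exact h n _
    · intro h n ξ
      obtain ⟨η, rfl⟩ := ModExt.exists_coconn_eq hs ξ
        (hG.ext_quotient_free_eq_zero (by lia) _)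
      rw [← map_smul]
      exact (h n η).coconn hs

theorem annihilator_localCohomology (M : ModuleCat.{0} R) [Module.Finite R M] {i j : ℕ}
    (hj : 1 ≤ j) (hd : i + j = d) :
    Module.annihilator R ((localCohomology 𝔪 i).obj M) = Module.annihilator R (ModExt R M R j) := by
  obtain ⟨j, rfl⟩ : ∃ j', j = j' + 1 := ⟨j - 1, by lia⟩
  ext x
  rw [mem_annihilator_localCohomology_iff, Module.mem_annihilator,
    hG.smul_ext_eq_zero_iff_dies j i hd M]

theorem syzDim_iff (M : ModuleCat.{0} R) [Module.Finite R M] (k : ℕ) :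
    SyzDim R d k M ↔ ∀ i : ℕ, (i : WithBot (WithTop ℕ)) < ringKrullDim R →
      mDim R ((localCohomology 𝔪 i).obj M) + (k : WithBot (WithTop ℕ)) ≤ i := by
  have hlt : ∀ i : ℕ, (i : WithBot (WithTop ℕ)) < ringKrullDim R ↔ i < d := fun i => by
    rw [hG.ringKrullDim_eq]
    exact_mod_cast Iff.rfl
  have hdim : ∀ i j : ℕ, 1 ≤ j → i + j = d →
      (mDim R ((localCohomology 𝔪 i).obj M) + (k : WithBot (WithTop ℕ)) ≤ i ↔
        DimLT R (ModExt R M R j) (d + 1 - j - k)) := fun i j hj hd => by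
    rw [add_natCast_le_iff, mDim_lt_iff, DimLT, hG.annihilator_localCohomology M hj hd, DimLT,
      show i + 1 - k = d + 1 - j - k by lia]
  constructor
  · intro h i hi
    rw [hlt] at hi
    exact (hdim i (d - i) (by lia) (by lia)).2 (h _ (by lia))
  · intro h j hj
    by_cases hjd : j ≤ d
    · exact (hdim (d - j) j hj (by lia)).1 (h _ ((hlt _).2 (by lia)))
    · have : Subsingleton (ModExt R M R j) :=
        subsingleton_of_forall_eq 0 (hG.vanish M j (by lia))
      exact (dimLT_zero_iff.2 this).mono (Nat.zero_le _)

end GorDim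

end LocalDuality

/-- Over a Gorenstein ring `R`, a finitely generated module `M` is a
`k`-syzygy iff `dim R/𝔞_i(M) ≤ i - k` for all `i < dim R`, where `𝔞_i(M)` is the
annihilator of `H^i_𝔪(M)`; and for `k ≥ 3` these conditions are equivalent to `M` being
reflexive with `Ext^i(M^*, R) = 0` for `1 ≤ i ≤ k - 2`. -/
theorem isKSyzygy_iff_dim_cohomology_annihilator
    (R : Type) [CommRing R] [IsLocalRing R] (hGor : IsGorensteinRing R)
    (M : ModuleCat R) [Module.Finite R M] (k : ℕ) :
    (IsKSyzygy R M k ↔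
      ∀ i : ℕ, (i : WithBot (WithTop ℕ)) < ringKrullDim R →
        mDim R ((localCohomology (IsLocalRing.maximalIdeal R) i).obj M) +
            (k : WithBot (WithTop ℕ)) ≤ (i : WithBot (WithTop ℕ))) ∧
    (3 ≤ k →
      (IsKSyzygy R M k ↔
        (Module.IsReflexive R M ∧
          ∀ i : ℕ, 1 ≤ i → i ≤ k - 2 →
            Subsingleton
              (RExt R (ModuleCat.of R (Module.Dual R M)) (ModuleCat.of R R) i)))) := by
  have : IsNoetherianRing R := hGor.1
  obtain ⟨d, hG⟩ := exists_gorDim hGor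
  refine ⟨(hG.isKSyzygy_iff_syzDim k M).trans (hG.syzDim_iff M k), fun hk => ?_⟩
  rw [hG.isKSyzygy_iff_reflexive hk M]
  refine and_congr_right fun _ => forall_congr' fun i => forall_congr' fun _ => ?_
  obtain ⟨e⟩ := exists_linearEquiv_modExt (ModuleCat.of R (Module.Dual R M)) (ModuleCat.of R R) i
  constructor
  · intro h hi
    have : Subsingleton (ModExt R (Module.Dual R M) R i) :=
      subsingleton_of_forall_eq 0 (h (by lia))
    exact e.injective.subsingleton
  · intro h hi ξ
    have := h (by lia)
    have : Subsingleton (ModExt R (Module.Dual R M) R i) := e.symm.injective.subsingleton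
    exact Subsingleton.elim _ _
end
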